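/- Let N ⊆ M be an inclusion of II₁ factors with N' ∩ M = ℂ1 such that a corner of M embeds into N inside M, witnessed by nonzero projections p ∈ M, q ∈ N, a unital *-homomorphism φ: pMp → qNq, and a nonzero partial isometry v ∈ qMp with φ(x)v = vx for all x ∈ pMp. Then after cutting by a suitable nonzero projection r ∈ φ(pMp)' ∩ qNq one may additionally assume that B := φ(pMp) satisfies B' ∩ qNq = ℂq; in that case ⟨qNq, vv*⟩ = qMq is the basic construction of B ⊆ qNq, the inclusion B ⊆ qNq has finite Jones index, and consequently [M : N] < ∞. -/

import Mathlib

open scoped ComplexOrder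
open Filter

namespace PopaQ

variable {H : Type u} [NormedAddCommGroup H] [InnerProductSpace ℂ H] [CompleteSpace H]

/-- Bounded operators on `H`. -/
abbrev Op (H : Type u) [NormedAddCommGroup H] [InnerProductSpace ℂ H] [CompleteSpace H] :=
  H →L[ℂ] H

/-- The relative commutant `N' ∩ M` (as sets of operators). -/
def relComm (N M : Set (Op H)) : Set (Op H) :=
  {x | x ∈ M ∧ ∀ y ∈ N, y * x = x * y}

/-- The scalar operators `ℂ 1`. -/
def scalars (H : Type u) [NormedAddCommGroup H] [InnerProductSpace ℂ H] [CompleteSpace H] :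
    Set (Op H) :=
  {x | ∃ c : ℂ, x = c • (1 : Op H)}

/-- A (self-adjoint) projection. -/
def IsProjection (p : Op H) : Prop :=
  IsSelfAdjoint p ∧ IsIdempotentElem p

/-- `τ` is a faithful tracial state on `M`. -/
structure IsTracialState (M : Set (Op H)) (τ : Op H →ₗ[ℂ] ℂ) : Prop where
  map_one : τ 1 = 1
  tracial : ∀ x ∈ M, ∀ y ∈ M, τ (x * y) = τ (y * x)
  pos : ∀ x ∈ M, 0 ≤ τ (star x * x)
  faithful : ∀ x ∈ M, τ (star x * x) = 0 → x = 0

/-- A set of operators is finite dimensional as a complex vector space. -/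
def FinDim (S : Set (Op H)) : Prop :=
  ∃ s : Finset (Op H), S ⊆ (Submodule.span ℂ (s : Set (Op H)) : Set (Op H))

/-- `M` is a II₁ factor with faithful normal trace `τ`:
a factor (trivial center) carrying a faithful tracial state, which is
infinite dimensional. -/
structure IsII1Factor (M : VonNeumannAlgebra H) (τ : Op H →ₗ[ℂ] ℂ) : Prop where
  factor : relComm (M : Set (Op H)) (M : Set (Op H)) = scalars H
  trace : IsTracialState (M : Set (Op H)) τ
  infdim : ¬ FinDim (M : Set (Op H))

/-- `M` is hyperfinite: it is the (weak closure = double commutant) of an increasing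
union of finite-dimensional *-subalgebras. -/
def IsHyperfinite (M : VonNeumannAlgebra H) : Prop :=
  ∃ A : ℕ → StarSubalgebra ℂ (Op H),
    Monotone A ∧ (∀ n, (A n : Set (Op H)) ⊆ M) ∧ (∀ n, FinDim (A n : Set (Op H))) ∧
    Set.centralizer (Set.centralizer (⋃ n, (A n : Set (Op H)))) = (M : Set (Op H))

/-- A bounded sequence of operators. -/
def Bdd (x : ℕ → Op H) : Prop :=
  ∃ C : ℝ, ∀ n, ‖x n‖ ≤ C

/-- A sequence taking values in `S`. -/
def SeqIn (S : Set (Op H)) (x : ℕ → Op H) : Prop :=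
  ∀ n, x n ∈ S

/-- A free ultrafilter on ℕ. -/
def IsFreeUltrafilter (ω : Ultrafilter ℕ) : Prop :=
  ∀ s : Set ℕ, s.Finite → s ∉ ω

/-- `Mω` is the tracial ultrapower of `M` along `ω`, with trace `τ`;
`limω` assigns to each bounded sequence in `M` its class in `Mω` (the diagonal
embedding of `M` into `Mω` being the identity on `M`). -/
structure IsTracialUltrapower (ω : Ultrafilter ℕ) (M Mω : VonNeumannAlgebra H)
    (τ : Op H →ₗ[ℂ] ℂ) (limω : (ℕ → Op H) → Op H) : Prop where
  subset : (M : Set (Op H)) ⊆ (Mω : Set (Op H))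
  mem : ∀ x, SeqIn (M : Set (Op H)) x → Bdd x → limω x ∈ Mω
  diag : ∀ m ∈ M, limω (fun _ => m) = m
  map_add : ∀ x y, SeqIn (M : Set (Op H)) x → Bdd x → SeqIn (M : Set (Op H)) y → Bdd y →
    limω (fun n => x n + y n) = limω x + limω y
  map_mul : ∀ x y, SeqIn (M : Set (Op H)) x → Bdd x → SeqIn (M : Set (Op H)) y → Bdd y →
    limω (fun n => x n * y n) = limω x * limω y
  map_smul : ∀ (c : ℂ) x, SeqIn (M : Set (Op H)) x → Bdd x →
    limω (fun n => c • x n) = c • limω x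
  map_star : ∀ x, SeqIn (M : Set (Op H)) x → Bdd x →
    limω (fun n => star (x n)) = star (limω x)
  surj : ∀ z ∈ Mω, ∃ x, SeqIn (M : Set (Op H)) x ∧ Bdd x ∧ limω x = z
  tr : ∀ x, SeqIn (M : Set (Op H)) x → Bdd x →
    Tendsto (fun n => τ (x n)) (ω : Filter ℕ) (nhds (τ (limω x)))
  eq_zero : ∀ x, SeqIn (M : Set (Op H)) x → Bdd x →
    (limω x = 0 ↔ Tendsto (fun n => ‖τ (star (x n) * x n)‖) (ω : Filter ℕ) (nhds 0))
  traceState : IsTracialState (Mω : Set (Op H)) τ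

/-- The ultrapower `N^ω ⊆ M^ω` of a subalgebra `N ⊆ M`: classes of bounded
sequences with entries in `N`. -/
def ultrapowerSet (limω : (ℕ → Op H) → Op H) (N : Set (Op H)) : Set (Op H) :=
  {z | ∃ x, SeqIn N x ∧ Bdd x ∧ limω x = z}

/-- `θ` is a *-homomorphism from `S` to `T` (as sets of operators). -/
def IsStarHomOn (θ : Op H → Op H) (S T : Set (Op H)) : Prop :=
  (∀ x ∈ S, θ x ∈ T) ∧
  (∀ x ∈ S, ∀ y ∈ S, θ (x + y) = θ x + θ y) ∧
  (∀ x ∈ S, ∀ y ∈ S, θ (x * y) = θ x * θ y) ∧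
  (∀ (c : ℂ), ∀ x ∈ S, θ (c • x) = c • θ x) ∧
  (∀ x ∈ S, θ (star x) = star (θ x))

/-- The corner `p S p` of a set of operators. -/
def corner (p : Op H) (S : Set (Op H)) : Set (Op H) :=
  {x | x ∈ S ∧ p * x * p = x}

/-- Popa's intertwining relation: a corner of `P` embeds into `Q` inside `M`,
written `P ≺_M Q`: there are nonzero projections `p ∈ P`, `q ∈ Q`, a
*-homomorphism `θ : pPp → qQq` and a nonzero partial isometry `v ∈ qMp` with
`θ(x) v = v x` for all `x ∈ pPp`. -/
def CornerEmbeds (P Q M : Set (Op H)) : Prop :=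
  ∃ (p q v : Op H) (θ : Op H → Op H),
    p ∈ P ∧ IsProjection p ∧ p ≠ 0 ∧
    q ∈ Q ∧ IsProjection q ∧ q ≠ 0 ∧
    IsStarHomOn θ (corner p P) (corner q Q) ∧
    v ∈ M ∧ v ≠ 0 ∧ IsProjection (star v * v) ∧ q * v * p = v ∧
    ∀ x ∈ corner p P, θ x * v = v * x

/-- `E` is the (`τ`-preserving) conditional expectation from `M` onto `Q`. -/
structure IsCondExp (τ : Op H →ₗ[ℂ] ℂ) (M Q : Set (Op H)) (E : Op H → Op H) : Prop where
  mem : ∀ x ∈ M, E x ∈ Q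
  fix : ∀ q ∈ Q, E q = q
  map_add : ∀ x ∈ M, ∀ y ∈ M, E (x + y) = E x + E y
  map_smul : ∀ (c : ℂ), ∀ x ∈ M, E (c • x) = c • E x
  bimod : ∀ a ∈ Q, ∀ x ∈ M, ∀ b ∈ Q, E (a * x * b) = a * E x * b
  tr : ∀ x ∈ M, τ (E x) = τ x

/-- `c` is a Pimsner–Popa bound for the inclusion `Q ⊆ M` with conditional
expectation `E`: every positive `x ∈ M` satisfies `x ≤ c E(x)`. -/
def IndexBound (M : Set (Op H)) (E : Op H → Op H) (c : ℝ) : Prop :=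
  ∀ x ∈ M, x.IsPositive → (c • E x - x).IsPositive

/-- The inclusion `Q ⊆ M` (with conditional expectation `E`) has finite Jones index. -/
def HasFiniteIndex (M : Set (Op H)) (E : Op H → Op H) : Prop :=
  ∃ c : ℝ, 0 < c ∧ IndexBound M E c

/-- The Jones index `[M : Q]` of an inclusion `Q ⊆ M` with conditional expectation `E`,
via the Pimsner–Popa characterization as the optimal constant `c` with
`x ≤ c E(x)` for all positive `x ∈ M`. -/
noncomputable def jonesIndex (M : Set (Op H)) (E : Op H → Op H) : ℝ :=
  sInf {c : ℝ | 0 < c ∧ IndexBound M E c}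

section part1

/-- star-closed set -/
def SC (S : Set (Op H)) : Prop := ∀ x ∈ S, star x ∈ S

theorem opmul (a b : Op H) (ξ : H) : (a * b) ξ = a (b ξ) := rfl

theorem cent_comm {S : Set (Op H)} {x : Op H} (hx : x ∈ Set.centralizer S) {s : Op H} (hs : s ∈ S) :
    s * x = x * s := hx s hs

theorem cent_star {S : Set (Op H)} (hS : SC S) {x : Op H} (hx : x ∈ Set.centralizer S) :
    star x ∈ Set.centralizer S := by
  intro s hs
  have := hx _ (hS s hs)
  have h2 := congrArg star this
  simpa using h2.symm

theorem inner_star_left (x : Op H) (a b : H) : inner ℂ ((star x) a) b = inner ℂ a (x b) := by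
  rw [ContinuousLinearMap.star_eq_adjoint, ContinuousLinearMap.adjoint_inner_left]

theorem inner_star_right (x : Op H) (a b : H) : inner ℂ a ((star x) b) = inner ℂ (x a) b := by
  rw [ContinuousLinearMap.star_eq_adjoint, ContinuousLinearMap.adjoint_inner_right]

theorem proj_mem {S : Set (Op H)} (hS : SC S) (K : Submodule ℂ H) [K.HasOrthogonalProjection]
    (hK : ∀ s ∈ S, ∀ ξ ∈ K, s ξ ∈ K) : K.starProjection ∈ Set.centralizer S := by
  have h1 : ∀ s ∈ S, s * K.starProjection = K.starProjection * s * K.starProjection := by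
    intro s hs
    ext ξ
    simp only [opmul]
    symm
    apply Submodule.starProjection_eq_self_iff.mpr
    exact hK s hs _ (Submodule.starProjection_apply_mem K ξ)
  have hsa : star K.starProjection = K.starProjection :=
    (isSelfAdjoint_starProjection K)
  intro s hs
  have h2 := congrArg star (h1 _ (hS s hs))
  simp only [star_mul, star_star, hsa] at h2
  rw [h1 s hs, mul_assoc]
  exact h2.symm

theorem ultralimit {ι : Type*} (U : Ultrafilter ι) (x : ι → Op H) (C : ℝ) (hC : ∀ i, ‖x i‖ ≤ C) :
    ∃ X : Op H, ∀ ξ η : H, Tendsto (fun i => inner ℂ (x i η) ξ) U (nhds (inner ℂ (X η) ξ)) := by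
  have hb : ∀ i (η ξ : H), ‖inner ℂ (x i η) ξ‖ ≤ C * ‖η‖ * ‖ξ‖ := by
    intro i η ξ
    refine (norm_inner_le_norm _ _).trans ?_
    gcongr
    exact (x i).le_of_opNorm_le (hC i) η
  have hlim : ∀ (η ξ : H), ∃ z : ℂ, ‖z‖ ≤ C * ‖η‖ * ‖ξ‖ ∧
      Tendsto (fun i => inner ℂ (x i η) ξ) U (nhds z) := by
    intro η ξ
    have hcpt : IsCompact (Metric.closedBall (0:ℂ) (C * ‖η‖ * ‖ξ‖)) := isCompact_closedBall _ _
    obtain ⟨z, hz, hle⟩ := hcpt.ultrafilter_le_nhds (U.map (fun i => inner ℂ (x i η) ξ)) (by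
      rw [Filter.le_principal_iff]
      refine Filter.mem_map.mpr (Filter.univ_mem' ?_)
      intro i
      simpa using hb i η ξ)
    exact ⟨z, by simpa using hz, hle⟩
  choose B hB hT using hlim
  let L : H →ₗ⋆[ℂ] H →ₗ[ℂ] ℂ := LinearMap.mk₂'ₛₗ (starRingEnd ℂ) (RingHom.id ℂ) B
    (by
      intro a b c
      refine tendsto_nhds_unique (hT _ _) ?_
      simpa [inner_add_left] using (hT a c).add (hT b c))
    (by
      intro a b c
      refine tendsto_nhds_unique (hT _ _) ?_
      simpa [inner_smul_left, mul_comm] using (hT b c).const_mul ((starRingEnd ℂ) a))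
    (by
      intro a b c
      refine tendsto_nhds_unique (hT _ _) ?_
      simpa [inner_add_right] using (hT a b).add (hT a c))
    (by
      intro a b c
      refine tendsto_nhds_unique (hT _ _) ?_
      simpa [inner_smul_right] using (hT b c).const_mul a)
  let L' : H →L⋆[ℂ] H →L[ℂ] ℂ := L.mkContinuous₂ C (fun a b => hB a b)
  refine ⟨InnerProductSpace.continuousLinearMapOfBilin L', fun ξ η => ?_⟩
  rw [InnerProductSpace.continuousLinearMapOfBilin_apply]
  exact hT η ξ

theorem ultralimit_mem {ι : Type*} (U : Ultrafilter ι) (x : ι → Op H) {S : Set (Op H)}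
    (hx : ∀ i, x i ∈ Set.centralizer S) {X : Op H}
    (hX : ∀ ξ η : H, Tendsto (fun i => inner ℂ (x i η) ξ) U (nhds (inner ℂ (X η) ξ))) :
    X ∈ Set.centralizer S := by
  intro s hs
  ext η
  refine ext_inner_right ℂ fun ξ => ?_
  simp only [opmul]
  refine tendsto_nhds_unique ?_ (hX ξ (s η))
  have h := hX (star s ξ) η
  simp only [inner_star_right] at h
  refine h.congr (fun i => ?_)
  have := congrArg (fun T : Op H => T η) (hx i s hs)
  simp only [opmul] at this
  rw [this]

theorem ultralimit_mul_left {ι : Type*} (U : Ultrafilter ι) (x : ι → Op H) {X : Op H}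
    (hX : ∀ ξ η : H, Tendsto (fun i => inner ℂ (x i η) ξ) U (nhds (inner ℂ (X η) ξ))) (a : Op H) :
    ∀ ξ η : H, Tendsto (fun i => inner ℂ ((a * x i) η) ξ) U (nhds (inner ℂ ((a * X) η) ξ)) := by
  intro ξ η
  have h := hX (star a ξ) η
  simpa only [inner_star_right, opmul] using h

theorem nonneg_iff_inner (T : Op H) : 0 ≤ T ↔ ∀ ξ, 0 ≤ inner ℂ (T ξ) ξ := by
  rw [ContinuousLinearMap.nonneg_iff_isPositive]
  constructor
  · intro h ξ
    exact h.inner_nonneg_left ξ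
  · intro h
    rw [ContinuousLinearMap.isPositive_iff_complex]
    intro ξ
    have := Complex.nonneg_iff.mp (h ξ)
    refine ⟨?_, this.1⟩
    apply Complex.ext
    · simp
    · simpa using this.2

theorem le_iff_inner (S T : Op H) : S ≤ T ↔ ∀ ξ, inner ℂ (S ξ) ξ ≤ inner ℂ (T ξ) ξ := by
  rw [← sub_nonneg, nonneg_iff_inner]
  simp

theorem cent_real {S : Set (Op H)} {x : Op H} (hx : x ∈ Set.centralizer S) (f : ℝ → ℝ) :
    cfc f x ∈ Set.centralizer S := by
  intro s hs
  have : Commute x s := (hx s hs).symm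
  exact (this.cfc_real f).symm.eq

theorem cent_posPart {S : Set (Op H)} {x : Op H} (hx : x ∈ Set.centralizer S) :
    x⁺ ∈ Set.centralizer S := by
  intro s hs
  have : Commute x s := (hx s hs).symm
  exact (this.cfcₙ_real _).symm.eq

theorem cent_negPart {S : Set (Op H)} {x : Op H} (hx : x ∈ Set.centralizer S) :
    x⁻ ∈ Set.centralizer S := by
  intro s hs
  have : Commute x s := (hx s hs).symm
  exact (this.cfcₙ_real _).symm.eq

theorem cent_sqrt {S : Set (Op H)} {x : Op H} (hx : x ∈ Set.centralizer S) :
    CFC.sqrt x ∈ Set.centralizer S := by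
  intro s hs
  have : Commute x s := (hx s hs).symm
  exact (this.cfcₙ_nnreal _).symm.eq

theorem star_mul_self_zero {x : Op H} (h : star x * x = 0) : x = 0 := by
  exact (CStarRing.star_mul_self_eq_zero_iff x).mp h

end part1

section part2

theorem supp_exists {S : Set (Op H)} (hS : SC S) {x : Op H} (hx : x ∈ Set.centralizer S) :
    ∃ g ∈ Set.centralizer S, IsProjection g ∧ x * g = x ∧ ∀ b : Op H, x * b = 0 → g * b = 0 := by
  let K : Submodule ℂ H := LinearMap.ker (x : H →ₗ[ℂ] H)
  have hKc : IsClosed (K : Set H) := x.isClosed_ker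
  have : CompleteSpace K := hKc.completeSpace_coe
  have hmem : ∀ ξ, ξ ∈ K ↔ x ξ = 0 := fun ξ => LinearMap.mem_ker
  have hP : K.starProjection ∈ Set.centralizer S := by
    apply proj_mem hS
    intro s hs ξ hξ
    rw [hmem] at hξ ⊢
    have := congrArg (fun T : Op H => T ξ) (hx s hs)
    simp only [opmul, hξ, map_zero] at this
    exact this.symm
  have hsa : star K.starProjection = K.starProjection := isSelfAdjoint_starProjection K
  have hid : K.starProjection * K.starProjection = K.starProjection :=
    K.isIdempotentElem_starProjection
  have hxP : x * K.starProjection = 0 := by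
    ext ξ
    exact (hmem _).mp (Submodule.starProjection_apply_mem K ξ)
  refine ⟨1 - K.starProjection, ?_, ⟨?_, ?_⟩, ?_, ?_⟩
  · intro s hs
    rw [mul_sub, sub_mul, hP s hs]; simp
  · rw [IsSelfAdjoint, star_sub, star_one, hsa]
  · rw [IsIdempotentElem]; simp [mul_sub, sub_mul, hid]
  · rw [mul_sub, hxP]; simp
  · intro b hb
    have : K.starProjection * b = b := by
      ext ξ
      apply Submodule.starProjection_eq_self_iff.mpr
      rw [hmem]
      exact congrArg (fun T : Op H => T ξ) hb
    rw [sub_mul, this]; simp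

theorem coe_eq_cent (M : VonNeumannAlgebra H) :
    (M : Set (Op H)) = Set.centralizer (Set.centralizer (M : Set (Op H))) :=
  M.centralizer_centralizer.symm

theorem SC_comm (M : VonNeumannAlgebra H) : SC (Set.centralizer (M : Set (Op H))) := by
  intro x hx
  exact cent_star (fun y hy => star_mem (S := VonNeumannAlgebra H) hy) hx

theorem irr_zero (M N : VonNeumannAlgebra H) (hNM : (N : Set (Op H)) ⊆ (M : Set (Op H)))
    (hirr : relComm (N : Set (Op H)) (M : Set (Op H)) = scalars H) {a b : Op H}
    (hb : b ∈ M) (h : ∀ n ∈ N, a * n * b = 0) : a = 0 ∨ b = 0 := by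
  let K0 : Submodule ℂ H := Submodule.span ℂ {ζ | ∃ n ∈ N, ∃ ξ : H, ζ = n (b ξ)}
  let K : Submodule ℂ H := K0.topologicalClosure
  have : CompleteSpace K := (Submodule.isClosed_topologicalClosure K0).completeSpace_coe
  have inv : ∀ s : Op H, (∀ n ∈ N, ∀ ξ : H, s (n (b ξ)) ∈ K0) → ∀ ζ ∈ K, s ζ ∈ K := by
    intro s hs
    have h1 : K0 ≤ K0.comap (s : H →ₗ[ℂ] H) := by
      apply Submodule.span_le.mpr
      rintro ζ ⟨n, hn, ξ, rfl⟩
      exact hs n hn ξ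
    intro ζ hζ
    have hc : IsClosed {ζ : H | s ζ ∈ K} :=
      (Submodule.isClosed_topologicalClosure K0).preimage s.continuous
    have : closure (K0 : Set H) ⊆ {ζ : H | s ζ ∈ K} :=
      closure_minimal (fun z hz => Submodule.le_topologicalClosure K0 (h1 hz)) hc
    exact this hζ
  have hPN : K.starProjection ∈ Set.centralizer (N : Set (Op H)) := by
    apply proj_mem (fun y hy => star_mem (S := VonNeumannAlgebra H) hy)
    intro s hs
    apply inv
    intro n hn ξ
    exact Submodule.subset_span ⟨s * n, mul_mem hs hn, ξ, rfl⟩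
  have hPM : K.starProjection ∈ (M : Set (Op H)) := by
    rw [coe_eq_cent]
    apply proj_mem (SC_comm M)
    intro s hs
    apply inv
    intro n hn ξ
    refine Submodule.subset_span ⟨n, hn, s ξ, ?_⟩
    have := congrArg (fun T : Op H => T ξ) (hs (n * b) (mul_mem (hNM hn) hb))
    simpa [opmul] using this.symm
  have : K.starProjection ∈ relComm (N : Set (Op H)) (M : Set (Op H)) := ⟨hPM, fun y hy => hPN y hy⟩
  rw [hirr] at this
  obtain ⟨c, hc⟩ := this
  have hid : K.starProjection * K.starProjection = K.starProjection :=
    K.isIdempotentElem_starProjection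
  have hPb : K.starProjection * b = b := by
    ext ξ
    apply Submodule.starProjection_eq_self_iff.mpr
    exact Submodule.le_topologicalClosure K0 (Submodule.subset_span ⟨1, one_mem N, ξ, rfl⟩)
  have haP : a * K.starProjection = 0 := by
    have hk : K ≤ LinearMap.ker (a : H →ₗ[ℂ] H) := by
      apply Submodule.topologicalClosure_minimal
      · apply Submodule.span_le.mpr
        rintro ζ ⟨n, hn, ξ, rfl⟩
        exact congrArg (fun T : Op H => T ξ) (h n hn)
      · exact a.isClosed_ker
    ext ξ
    exact hk (Submodule.starProjection_apply_mem K ξ)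
  by_cases hc0 : c = 0
  · right
    rw [← hPb, hc, hc0]; simp
  · left
    rw [hc] at haP
    simpa [hc0] using haP

theorem le_aux {a b c : ℝ} (hb : 0 ≤ b) (h : ∀ t > c, a ≤ t * b) : a ≤ c * b := by
  by_contra hcon
  push Not at hcon
  have hε : 0 < (a - c * b) / (2 * (b + 1)) := by
    apply div_pos <;> linarith
  have := h (c + (a - c * b) / (2 * (b + 1))) (by linarith)
  have h2 : (a - c * b) / (2 * (b + 1)) * b ≤ (a - c * b) / 2 := by
    rw [div_mul_eq_mul_div, div_le_div_iff₀ (by linarith) (by norm_num)]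
    nlinarith
  nlinarith

theorem re_inner_le {S T : Op H} (h : S ≤ T) (ξ : H) : (inner ℂ (S ξ) ξ).re ≤ (inner ℂ (T ξ) ξ).re :=
  (Complex.le_def.mp ((le_iff_inner S T).mp h ξ)).1

theorem sa_inner_im {S : Op H} (h : IsSelfAdjoint S) (ξ : H) : (inner ℂ (S ξ) ξ).im = 0 := by
  have h1 := inner_star_left S ξ ξ
  rw [h.star_eq] at h1
  have h2 := inner_conj_symm (𝕜 := ℂ) (S ξ) ξ
  rw [← h1] at h2
  have := congrArg Complex.im h2
  simp only [Complex.conj_im] at this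
  linarith

theorem le_of_re {S T : Op H} (hS : IsSelfAdjoint S) (hT : IsSelfAdjoint T)
    (h : ∀ ξ, (inner ℂ (S ξ) ξ).re ≤ (inner ℂ (T ξ) ξ).re) : S ≤ T := by
  rw [le_iff_inner]
  intro ξ
  rw [Complex.le_def]
  exact ⟨h ξ, by rw [sa_inner_im hS, sa_inner_im hT]⟩

theorem posPart_under {y r : Op H} (hy : IsSelfAdjoint y) (hc : Commute y r) (hr : IsProjection r)
    (hyr : y * r = y) : y⁺ * r = y⁺ := by
  have hc' : Commute y⁺ r := hc.cfcₙ_real _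
  have h0 : y⁺ * y⁺ = y⁺ * y := by
    have e := CFC.posPart_sub_negPart y hy
    calc y⁺ * y⁺ = y⁺ * (y⁺ - y⁻) := by rw [mul_sub, CFC.posPart_mul_negPart, sub_zero]
      _ = y⁺ * y := by rw [e]
  have hsa : star y⁺ = y⁺ := (IsSelfAdjoint.of_nonneg (CFC.posPart_nonneg y)).star_eq
  have : y⁺ * (1 - r) = 0 := by
    apply star_mul_self_zero
    rw [star_mul, hsa, mul_assoc, ← mul_assoc y⁺ y⁺, h0]
    have : y * (1 - r) = 0 := by rw [mul_sub, hyr]; simp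
    rw [mul_assoc y⁺, this]; simp
  rw [mul_sub, mul_one, sub_eq_zero] at this
  exact this.symm

theorem scalar_sa {S : Set (Op H)} {r : Op H} (hr : r ∈ Set.centralizer S)
    (hrp : IsProjection r)
    (hyp : ∀ a ∈ Set.centralizer S, ∀ b ∈ Set.centralizer S, 0 ≤ a → 0 ≤ b → a * r = a → b * r = b →
      a * b = 0 → a = 0 ∨ b = 0) {x : Op H} (hx : x ∈ Set.centralizer S) (hsa : IsSelfAdjoint x)
    (hxr : r * x = x) (hxr' : x * r = x) : ∃ c : ℝ, x = (c : ℂ) • r := by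
  by_cases hr0 : r = 0
  · exact ⟨0, by rw [← hxr, hr0]; simp⟩
  obtain ⟨ξ, hξ⟩ : ∃ ξ, r ξ ≠ 0 := by
    by_contra hcon
    push Not at hcon
    exact hr0 (by ext ξ; simpa using hcon ξ)
  have rr : r * r = r := hrp.2
  have dich : ∀ t : ℝ, x ≤ (t : ℂ) • r ∨ (t : ℂ) • r ≤ x := by
    intro t
    set y := x - (t : ℂ) • r with hy
    have hysa : IsSelfAdjoint y := by
      rw [IsSelfAdjoint, hy, star_sub, star_smul, hsa.star_eq, hrp.1.star_eq]
      simp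
    have hyc : y ∈ Set.centralizer S := by
      intro s hs
      rw [hy, mul_sub, sub_mul, hx s hs, mul_smul_comm, hr s hs, smul_mul_assoc]
    have hyr : y * r = y := by rw [hy, sub_mul, hxr', smul_mul_assoc, rr]
    have hyr' : r * y = y := by rw [hy, mul_sub, hxr, mul_smul_comm, rr]
    have hcomm : Commute y r := hyr.trans hyr'.symm
    have h1 := posPart_under hysa hcomm hrp hyr
    have h2 := posPart_under (y := -y) hysa.neg hcomm.neg_left hrp (by rw [neg_mul, hyr])
    rw [CFC.posPart_neg] at h2
    rcases hyp _ (cent_posPart hyc) _ (cent_negPart hyc) (CFC.posPart_nonneg y)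
      (CFC.negPart_nonneg y) h1 h2 (CFC.posPart_mul_negPart y) with h | h
    · left
      have := (CFC.posPart_eq_zero_iff y hysa).mp h
      exact sub_nonpos.mp this
    · right
      have := (CFC.negPart_eq_zero_iff y hysa).mp h
      exact sub_nonneg.mp this
  have hrsq : ∀ η, (inner ℂ (r η) η).re = ‖r η‖ ^ 2 := by
    intro η
    have h1 := inner_star_left r (r η) η
    rw [hrp.1.star_eq, ← opmul, rr] at h1
    rw [h1]
    simpa using inner_self_eq_norm_sq (𝕜 := ℂ) (r η)
  have hpos : 0 < ‖r ξ‖ ^ 2 := by positivity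
  set c : ℝ := (inner ℂ (x ξ) ξ).re / ‖r ξ‖ ^ 2 with hc
  have hcx : (inner ℂ (x ξ) ξ).re = c * ‖r ξ‖ ^ 2 := by rw [hc]; field_simp
  have reT : ∀ (t : ℝ) (η : H), (inner ℂ (((t : ℂ) • r) η) η).re = t * ‖r η‖ ^ 2 := by
    intro t η
    rw [_root_.smul_apply, inner_smul_left]
    simp [hrsq]
  have up : ∀ t > c, ∀ η, (inner ℂ (x η) η).re ≤ t * ‖r η‖ ^ 2 := by
    intro t ht η
    rcases dich t with h | h
    · have := re_inner_le h η
      rwa [reT] at this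
    · exfalso
      have := re_inner_le h ξ
      rw [reT, hcx] at this
      nlinarith
  have dn : ∀ t < c, ∀ η, t * ‖r η‖ ^ 2 ≤ (inner ℂ (x η) η).re := by
    intro t ht η
    rcases dich t with h | h
    · exfalso
      have := re_inner_le h ξ
      rw [reT, hcx] at this
      nlinarith
    · have := re_inner_le h η
      rwa [reT] at this
  have hcr : IsSelfAdjoint ((c : ℂ) • r) := by
    rw [IsSelfAdjoint, star_smul, hrp.1.star_eq]; simp
  refine ⟨c, le_antisymm ?_ ?_⟩
  · apply le_of_re hsa hcr
    intro η
    rw [reT]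
    exact le_aux (by positivity) (fun t ht => up t ht η)
  · apply le_of_re hcr hsa
    intro η
    rw [reT]
    have := le_aux (a := -(inner ℂ (x η) η).re) (b := ‖r η‖ ^ 2) (c := -c) (by positivity)
      (fun t ht => by have := dn (-t) (by linarith) η; linarith)
    linarith

theorem scalar_lemma {S : Set (Op H)} (hS : SC S) {r : Op H} (hr : r ∈ Set.centralizer S)
    (hrp : IsProjection r)
    (hyp : ∀ a ∈ Set.centralizer S, ∀ b ∈ Set.centralizer S, 0 ≤ a → 0 ≤ b → a * r = a → b * r = b →
      a * b = 0 → a = 0 ∨ b = 0) {x : Op H} (hx : x ∈ Set.centralizer S)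
    (hxr : r * x * r = x) : ∃ c : ℂ, x = c • r := by
  have rr : r * r = r := hrp.2
  have h1 : r * x = x := by rw [← hxr, ← mul_assoc, ← mul_assoc, rr]
  have h2 : x * r = x := by rw [← hxr, mul_assoc, rr]
  have h1' : star x * r = star x := by
    have := congrArg star h1; rwa [star_mul, hrp.1.star_eq] at this
  have h2' : r * star x = star x := by
    have := congrArg star h2; rwa [star_mul, hrp.1.star_eq] at this
  have hxs := cent_star hS hx
  obtain ⟨c, hc⟩ := scalar_sa hr hrp hyp (x := x + star x)
    (by intro s hs; rw [mul_add, add_mul, hx s hs, hxs s hs])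
    (by rw [IsSelfAdjoint, star_add, star_star, add_comm])
    (by rw [mul_add, h1, h2']) (by rw [add_mul, h2, h1'])
  obtain ⟨d, hd⟩ := scalar_sa hr hrp hyp (x := Complex.I • (x - star x))
    (by intro s hs; rw [mul_smul_comm, smul_mul_assoc, mul_sub, sub_mul, hx s hs, hxs s hs])
    (by rw [IsSelfAdjoint, star_smul, star_sub, star_star, Complex.star_def, Complex.conj_I]; module)
    (by rw [mul_smul_comm, mul_sub, h1, h2']) (by rw [smul_mul_assoc, sub_mul, h2, h1'])
  refine ⟨(c - Complex.I * d) / 2, ?_⟩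
  have hd' : x - star x = -(Complex.I * d) • r := by
    rw [neg_smul, mul_smul, ← hd, smul_smul, Complex.I_mul_I]; simp
  have : (2 : ℂ) • x = ((c : ℂ) - Complex.I * d) • r := by
    rw [sub_smul, ← hc, sub_eq_add_neg, ← neg_smul, ← hd', two_smul]; abel
  have h3 : x = (2 : ℂ)⁻¹ • ((2 : ℂ) • x) := by rw [smul_smul]; norm_num
  rw [h3, this, smul_smul]; congr 1; ring

end part2

section part3

theorem polar {S : Set (Op H)} (hS : SC S) {x : Op H} (hx : x ∈ Set.centralizer S) :
    ∃ u ∈ Set.centralizer S, IsProjection (star u * u) ∧ (u = 0 → x = 0) ∧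
      (∀ e, x * e = x → u * e = u) ∧ (∀ f, IsSelfAdjoint f → f * x = x → f * u = u) := by
  obtain ⟨g, hgS, hgp, hxg, hgb⟩ := supp_exists hS hx
  have hxs := cent_star hS hx
  set a : Op H := star x * x with ha
  have ha0 : 0 ≤ a := star_mul_self_nonneg x
  have haS : a ∈ Set.centralizer S := Set.mul_mem_centralizer hxs hx
  set T : Op H := CFC.sqrt a with hT
  have hT0 : 0 ≤ T := CFC.sqrt_nonneg a
  have hTT : T * T = a := CFC.sqrt_mul_sqrt_self a ha0
  have hTsa : IsSelfAdjoint T := IsSelfAdjoint.of_nonneg hT0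
  have hTS : T ∈ Set.centralizer S := cent_sqrt haS
  have hTb : ∀ b : Op H, T * b = 0 → g * b = 0 := by
    intro b hb
    apply hgb
    apply star_mul_self_zero
    rw [star_mul, mul_assoc, ← mul_assoc (star x), ← ha, ← hTT, mul_assoc, hb]
    simp
  have hTg : T * g = T := by
    have : T * (1 - g) = 0 := by
      apply star_mul_self_zero
      rw [star_mul, hTsa.star_eq, mul_assoc, ← mul_assoc T, hTT, ha, mul_assoc (star x), mul_sub,
        hxg]
      simp
    rw [mul_sub, mul_one, sub_eq_zero] at this
    exact this.symm
  have hgT : g * T = T := by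
    have := congrArg star hTg
    rwa [star_mul, hTsa.star_eq, hgp.1.star_eq] at this
  let ε : ℕ → ℝ := fun n => 1 / ((n : ℝ) + 1)
  have hε : ∀ n, 0 < ε n := fun n => Nat.one_div_pos_of_nat
  let F : ℕ → ℝ → ℝ := fun n t => (max t 0 + ε n)⁻¹
  have hF : ∀ n, Continuous (F n) := by
    intro n
    apply Continuous.inv₀ (by fun_prop)
    intro t
    have := hε n
    have := le_max_right t 0
    linarith
  let R : ℕ → Op H := fun n => cfc (F n) T
  have hspec : ∀ t ∈ spectrum ℝ T, 0 ≤ t := fun t ht => spectrum_nonneg_of_nonneg hT0 ht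
  have hTR : ∀ n, T * R n = cfc (fun t => t * F n t) T := by
    intro n
    have := cfc_mul (fun t : ℝ => t) (F n) T (by fun_prop) (hF n).continuousOn
    rw [this, cfc_id' ℝ T]
  have hTRn : ∀ n, ‖T * R n‖ ≤ 1 := by
    intro n
    rw [hTR]
    apply norm_cfc_le zero_le_one
    intro t ht
    have h0 := hspec t ht
    have := hε n
    simp only [F, max_eq_left h0]
    rw [Real.norm_of_nonneg (by positivity), ← div_eq_mul_inv, div_le_one (by positivity)]
    linarith
  have hRT : ∀ n, R n * T = 1 - (ε n) • R n := by
    intro n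
    have hc : Commute T (R n) := ((Commute.refl T).cfc_real (F n)).symm
    rw [← hc.eq, hTR, ← cfc_const_one ℝ T, ← cfc_smul (ε n) (F n) T (hF n).continuousOn,
      ← cfc_sub _ _ T (by fun_prop) (by have := hF n; fun_prop)]
    apply cfc_congr
    intro t ht
    have h0 := hspec t ht
    have := hε n
    simp only [F, max_eq_left h0, smul_eq_mul]
    have : t + ε n ≠ 0 := by positivity
    field_simp
    ring
  let un : ℕ → Op H := fun n => x * R n
  have hunS : ∀ n, un n ∈ Set.centralizer S := fun n =>
    Set.mul_mem_centralizer hx (cent_real hTS _)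
  have hnorm : ∀ n, ‖un n‖ ≤ 1 := by
    intro n
    have h1 : star (un n) * un n = star (T * R n) * (T * R n) := by
      simp only [un, star_mul, hTsa.star_eq]
      rw [mul_assoc, mul_assoc, ← mul_assoc T T, hTT, ← mul_assoc (star x)]
    have h2 : ‖un n‖ * ‖un n‖ = ‖T * R n‖ * ‖T * R n‖ := by
      rw [← CStarRing.norm_star_mul_self, ← CStarRing.norm_star_mul_self, h1]
    have h3 := hTRn n
    have h4 := norm_nonneg (T * R n)
    nlinarith [norm_nonneg (un n)]
  let U : Ultrafilter ℕ := Ultrafilter.of atTop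
  have hU : (U : Filter ℕ) ≤ atTop := Ultrafilter.of_le _
  obtain ⟨u, hu⟩ := ultralimit U un 1 hnorm
  have huS : u ∈ Set.centralizer S := ultralimit_mem U un hunS hu
  have huT : u * T = x := by
    ext η
    refine ext_inner_right ℂ fun ξ => ?_
    refine tendsto_nhds_unique (hu ξ (T η)) ?_
    have h1 : ∀ n, un n (T η) = x η - (ε n) • un n η := by
      intro n
      have : un n * T = x - (ε n) • un n := by
        simp only [un]; rw [mul_assoc, hRT, mul_sub, mul_one, mul_smul_comm]
      have := congrArg (fun A : Op H => A η) this
      simpa [opmul] using this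
    have h2 : Tendsto (fun n => (ε n) • un n η) U (nhds 0) := by
      apply Tendsto.mono_left _ hU
      apply squeeze_zero_norm (a := fun n => ε n * ‖η‖)
      · intro n
        rw [norm_smul, Real.norm_of_nonneg (hε n).le]
        gcongr
        simpa using (un n).le_of_opNorm_le (hnorm n) η
      · have := (tendsto_one_div_add_atTop_nhds_zero_nat (𝕜 := ℝ)).mul_const ‖η‖
        simpa [ε] using this
    have h3 : Tendsto (fun n => x η - (ε n) • un n η) U (nhds (x η)) := by
      simpa using tendsto_const_nhds.sub h2
    have h4 := h3.inner (𝕜 := ℂ) (tendsto_const_nhds (x := ξ))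
    refine h4.congr (fun n => by rw [h1])
  have hug : u * g = u := by
    ext η
    refine ext_inner_right ℂ fun ξ => ?_
    refine tendsto_nhds_unique (hu ξ (g η)) ?_
    refine (hu ξ η).congr (fun n => ?_)
    have h1 : un n * g = un n := by
      have hc : Commute (R n) g := by
        have : Commute T g := hTg.trans hgT.symm
        exact this.cfc_real _
      simp only [un]
      rw [mul_assoc, hc.eq, ← mul_assoc, hxg]
    have := congrArg (fun A : Op H => A η) h1
    simp only [opmul] at this
    rw [this]
  have hgu : g * star u = star u := by
    have := congrArg star hug
    rwa [star_mul, hgp.1.star_eq] at this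
  have gg : g * g = g := hgp.2
  have key : star u * u = g := by
    have hD : T * ((star u * u - g) * T) = 0 := by
      have : star (u * T) * (u * T) = a := by rw [huT]
      rw [star_mul, hTsa.star_eq] at this
      rw [sub_mul, mul_sub, hgT, hTT, ← this]
      simp [mul_assoc]
    have h1 := hTb _ hD
    rw [← mul_assoc, mul_sub, ← mul_assoc, hgu, gg] at h1
    have h2 := congrArg star h1
    rw [star_mul, hTsa.star_eq, star_sub, star_mul, star_star, hgp.1.star_eq, star_zero] at h2
    have h3 := hTb _ h2
    rw [mul_sub, ← mul_assoc, hgu, gg, sub_eq_zero] at h3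
    exact h3
  refine ⟨u, huS, ?_, ?_, ?_, ?_⟩
  · rw [key]; exact hgp
  · intro h0; rw [← huT, h0]; simp
  · intro e he
    have h1 : g * (1 - e) = 0 := hgb _ (by rw [mul_sub, he]; simp)
    have h2 : u * (1 - e) = 0 := by rw [← hug, mul_assoc, h1]; simp
    rw [mul_sub, mul_one, sub_eq_zero] at h2
    exact h2.symm
  · intro f hf hfx
    have h1 : T * (star u * (1 - f)) = 0 := by
      have : star (u * T) * (1 - f) = 0 := by
        rw [huT]
        have := congrArg star hfx
        rw [star_mul, hf.star_eq] at this
        rw [mul_sub, this]; simp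
      rwa [star_mul, hTsa.star_eq, mul_assoc] at this
    have h2 := hTb _ h1
    rw [← mul_assoc, hgu, mul_sub, mul_one, sub_eq_zero] at h2
    have h3 := congrArg star h2
    rw [star_mul, star_star, hf.star_eq] at h3
    exact h3.symm

theorem chain_ultra {α : Type*} (r : α → α → Prop) (hrefl : ∀ a, r a a)
    (htrans : ∀ a b c, r a b → r b c → r a c) (c : Set α) (hc : IsChain r c) (hne : c.Nonempty) :
    ∃ U : Ultrafilter c, ∀ a : c, ∀ᶠ b in (U : Filter c), r a.1 b.1 := by
  letI : Preorder c :=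
    { le := fun a b => r a.1 b.1
      le_refl := fun a => hrefl _
      le_trans := fun a b d h1 h2 => htrans _ _ _ h1 h2 }
  have : Nonempty c := hne.to_subtype
  have : IsDirected c (· ≤ ·) := ⟨fun a b => by
    rcases eq_or_ne a.1 b.1 with h | h
    · refine ⟨b, ?_, le_refl b⟩
      have : a = b := Subtype.ext h
      rw [this]
    · rcases hc a.2 b.2 h with h | h
      · exact ⟨b, h, le_refl b⟩
      · exact ⟨a, le_refl a, h⟩⟩
  refine ⟨Ultrafilter.of atTop, fun a => ?_⟩
  exact (Ultrafilter.of_le (atTop : Filter c)) (Filter.eventually_ge_atTop a)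

end part3

section part4

theorem mem_cc {M : VonNeumannAlgebra H} {x : Op H} :
    x ∈ M ↔ x ∈ Set.centralizer (Set.centralizer (M : Set (Op H))) := by
  rw [← coe_eq_cent]; rfl

theorem smul_memM {M : VonNeumannAlgebra H} {x : Op H} (c : ℂ) (h : x ∈ M) : c • x ∈ M := by
  rw [mem_cc] at *
  exact Set.smul_mem_centralizer c h

theorem rsmul_memM {M : VonNeumannAlgebra H} {x : Op H} (c : ℝ) (h : x ∈ M) : c • x ∈ M := by
  have := smul_memM (c : ℂ) h
  simpa using this

theorem lim_ext {ι : Type*} {U : Ultrafilter ι} {x : ι → Op H} {X : Op H}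
    (hX : ∀ ξ η : H, Tendsto (fun i => inner ℂ (x i η) ξ) U (nhds (inner ℂ (X η) ξ)))
    (b c : Op H) (h : ∀ᶠ i in (U : Filter ι), x i * b = c) : X * b = c := by
  ext η
  refine ext_inner_right ℂ fun ξ => ?_
  refine tendsto_nhds_unique (hX ξ (b η)) ?_
  refine Tendsto.congr' ?_ tendsto_const_nhds
  filter_upwards [h] with i hi
  rw [← opmul, hi]

theorem lim_ext2 {ι : Type*} {U : Ultrafilter ι} {x : ι → Op H} {X : Op H}
    (hX : ∀ ξ η : H, Tendsto (fun i => inner ℂ (x i η) ξ) U (nhds (inner ℂ (X η) ξ)))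
    (b : Op H) (h : ∀ᶠ i in (U : Filter ι), x i * b = x i) : X * b = X := by
  ext η
  refine ext_inner_right ℂ fun ξ => ?_
  refine tendsto_nhds_unique (hX ξ (b η)) ?_
  refine Tendsto.congr' ?_ (hX ξ η)
  filter_upwards [h] with i hi
  rw [← opmul, hi]

theorem lim_ext3 {ι : Type*} {U : Ultrafilter ι} {x : ι → Op H} {X : Op H}
    (hX : ∀ ξ η : H, Tendsto (fun i => inner ℂ (x i η) ξ) U (nhds (inner ℂ (X η) ξ)))
    (b : Op H) (h : ∀ᶠ i in (U : Filter ι), b * x i = x i) : b * X = X := by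
  ext η
  refine ext_inner_right ℂ fun ξ => ?_
  refine tendsto_nhds_unique (ultralimit_mul_left U x hX b ξ η) ?_
  refine Tendsto.congr' ?_ (hX ξ η)
  filter_upwards [h] with i hi
  rw [hi]

theorem lim_star {ι : Type*} {U : Ultrafilter ι} {x : ι → Op H} {X : Op H}
    (hX : ∀ ξ η : H, Tendsto (fun i => inner ℂ (x i η) ξ) U (nhds (inner ℂ (X η) ξ))) :
    ∀ ξ η : H, Tendsto (fun i => inner ℂ (star (x i) η) ξ) U (nhds (inner ℂ (star X η) ξ)) := by
  intro ξ η
  have h := (Complex.continuous_conj.tendsto _).comp (hX η ξ)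
  rw [inner_conj_symm, ← inner_star_left] at h
  refine h.congr fun i => ?_
  simp only [Function.comp]
  rw [inner_conj_symm, ← inner_star_left]

theorem pi_norm {u : Op H} (h : u * star u * u = u) : ‖u‖ ≤ 1 := by
  have h1 : ‖star u * u‖ = ‖u‖ * ‖u‖ := CStarRing.norm_star_mul_self
  have h2 : (star u * u) * (star u * u) = star u * u := by
    rw [mul_assoc, ← mul_assoc u, h]
  have h3 : ‖star u * u‖ ≤ ‖star u * u‖ * ‖star u * u‖ ∧ ‖star u * u‖ * ‖star u * u‖ ≤ ‖star u * u‖ := by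
    have := CStarRing.norm_star_mul_self (x := star u * u)
    rw [star_mul, star_star, h2] at this
    exact ⟨this.le, this.ge⟩
  rw [h1] at h3
  by_contra hc
  push Not at hc
  have : 1 < ‖u‖ * ‖u‖ := by nlinarith
  nlinarith

theorem comparison (M : VonNeumannAlgebra H)
    (hfac : relComm (M : Set (Op H)) (M : Set (Op H)) = scalars H) {e f : Op H}
    (he : e ∈ M) (hep : IsProjection e) (hf : f ∈ M) (hfp : IsProjection f) :
    ∃ v ∈ M, v * star v * v = v ∧ f * v = v ∧ v * e = v ∧ (star v * v = e ∨ v * star v = f) := by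
  let Z := {u : Op H // u ∈ M ∧ u * star u * u = u ∧ f * u = u ∧ u * e = u}
  let r : Z → Z → Prop := fun u v => v.1 * (star u.1 * u.1) = u.1
  have ee : e * e = e := hep.2
  have ff : f * f = f := hfp.2
  have hmulstar : ∀ u : Z, u.1 * (star u.1 * u.1) = u.1 := fun u => by
    rw [← mul_assoc]; exact u.2.2.1
  have hkey : ∀ u v : Z, r u v → (star v.1 * v.1) * (star u.1 * u.1) = star u.1 * u.1 := by
    intro u v h
    change v.1 * (star u.1 * u.1) = u.1 at h
    have hz : (v.1 * star v.1 * v.1) = v.1 := v.2.2.1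
    have hu := hmulstar u
    set a := star u.1 * u.1 with ha
    set b := star v.1 * v.1 with hb
    have aa : a * a = a := by rw [ha, mul_assoc, hu]
    have bb : b * b = b := by rw [hb, mul_assoc, hmulstar v]
    have as : star a = a := by simp [ha]
    have bs : star b = b := by simp [hb]
    have hab : a * b * a = a := by
      have : star (v.1 * a) * (v.1 * a) = a := by rw [h]
      rw [star_mul, as, mul_assoc, ← mul_assoc (star v.1), ← hb, ← mul_assoc] at this
      exact this
    have : (1 - b) * a = 0 := by
      apply star_mul_self_zero
      rw [star_mul, star_sub, as, bs, star_one, mul_assoc, ← mul_assoc (1 - b)]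
      have : (1 - b) * (1 - b) = 1 - b := by rw [mul_sub, sub_mul, sub_mul, bb]; simp
      rw [this, sub_mul, mul_sub, ← mul_assoc a b, hab, one_mul, aa, sub_self]
    rw [sub_mul, one_mul, sub_eq_zero] at this
    exact this.symm
  have hrefl : ∀ u : Z, r u u := hmulstar
  have htrans : ∀ a b c : Z, r a b → r b c → r a c := by
    intro a b c h1 h2
    have h3 := hkey a b h1
    change c.1 * (star a.1 * a.1) = a.1
    change c.1 * (star b.1 * b.1) = b.1 at h2
    rw [← h3, ← mul_assoc, h2]
    exact h1
  have hch : ∀ c : Set Z, IsChain r c → ∃ ub, ∀ a ∈ c, r a ub := by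
    intro c hc
    rcases c.eq_empty_or_nonempty with h0 | hne
    · refine ⟨⟨0, zero_mem M, by simp, by simp, by simp⟩, ?_⟩
      intro a ha; rw [h0] at ha; exact ha.elim
    obtain ⟨U, hU⟩ := chain_ultra r hrefl htrans c hc hne
    let x : c → Op H := fun i => i.1.1
    obtain ⟨w, hw⟩ := ultralimit U x 1 (fun i => pi_norm i.1.2.2.1)
    have hwM : w ∈ M := by
      rw [mem_cc]
      exact ultralimit_mem U x (fun i => mem_cc.mp i.1.2.1) hw
    have hwa : ∀ i : c, w * (star (x i) * x i) = x i := fun i => lim_ext hw _ _ (hU i)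
    have hwu : ∀ i : c, star w * x i = star (x i) * x i := by
      intro i
      refine lim_ext (lim_star hw) _ _ ?_
      filter_upwards [hU i] with j hj
      have h1 := hkey _ _ hj
      change x j * (star (x i) * x i) = x i at hj
      change (star (x j) * x j) * (star (x i) * x i) = star (x i) * x i at h1
      calc star (x j) * x i = star (x j) * (x j * (star (x i) * x i)) := by rw [hj]
        _ = _ := by rw [← mul_assoc, h1]
    have hww : ∀ i : c, x i * (star w * w) = x i := by
      intro i
      have h1 : star w * w * (star (x i) * x i) = star (x i) * x i := by
        rw [mul_assoc, hwa, hwu]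
      have h2 := congrArg star h1
      rw [star_mul, star_mul, star_mul, star_star, star_star] at h2
      calc x i * (star w * w) = x i * (star (x i) * x i) * (star w * w) := by
            rw [hmulstar i.1]
        _ = x i * (star (x i) * x i) := by rw [mul_assoc (x i), h2]
        _ = x i := hmulstar i.1
    refine ⟨⟨w, hwM, ?_, ?_, ?_⟩, ?_⟩
    · rw [mul_assoc]; exact lim_ext2 hw _ (Eventually.of_forall hww)
    · exact lim_ext3 hw _ (Eventually.of_forall fun i => i.1.2.2.2.1)
    · exact lim_ext2 hw _ (Eventually.of_forall fun i => i.1.2.2.2.2)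
    · intro a ha
      exact hwa ⟨a, ha⟩
  obtain ⟨⟨u, huM, hu1, hu2, hu3⟩, hmax⟩ := exists_maximal_of_chains_bounded hch (htrans _ _ _)
  refine ⟨u, huM, hu1, hu2, hu3, ?_⟩
  have hsu : star u * f = star u := by
    have := congrArg star hu2
    rwa [star_mul, hfp.1.star_eq] at this
  have hsu' : e * star u = star u := by
    have := congrArg star hu3
    rwa [star_mul, hep.1.star_eq] at this
  have hu1' : u * (star u * u) = u := by rw [← mul_assoc]; exact hu1
  have hsu1 : star u * (u * star u) = star u := by
    have := congrArg star hu1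
    simpa [mul_assoc] using this
  set e' := e - star u * u with he'
  set f' := f - u * star u with hf'
  have huM' : star u ∈ M := star_mem huM
  have he'M : e' ∈ M := sub_mem he (mul_mem huM' huM)
  have hf'M : f' ∈ M := sub_mem hf (mul_mem huM huM')
  have e's : star e' = e' := by simp [he', hep.1.star_eq]
  have f's : star f' = f' := by simp [hf', hfp.1.star_eq]
  have ue' : u * e' = 0 := by rw [he', mul_sub, hu3, hu1', sub_self]
  have uf' : star u * f' = 0 := by rw [hf', mul_sub, hsu, hsu1, sub_self]
  have fu' : f' * u = 0 := by have := congrArg star uf'; rwa [star_mul, star_star, f's, star_zero] at this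
  have e'e : e' * e = e' := by rw [he', sub_mul, ee, mul_assoc, hu3]
  have ff' : f * f' = f' := by rw [hf', mul_sub, ff, ← mul_assoc, hu2]
  have e'e' : e' * e' = e' := by
    have : e' * e' = e' * e - (star (u * e')) * u := by
      rw [he', star_mul, ← he', e's, mul_assoc, ← mul_sub]
    rw [this, ue', e'e]; simp
  have f'f' : f' * f' = f' := by
    have : f' * f' = f * f' - u * (star u * f') := by
      nth_rw 1 [hf']; rw [sub_mul, mul_assoc]
    rw [this, uf', ff']; simp
  have hall : ∀ m ∈ M, f' * m * e' = 0 := by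
    intro m hm
    have hxM : f' * m * e' ∈ M := mul_mem (mul_mem hf'M hm) he'M
    obtain ⟨u', hu'M, hu'p, hu'0, hu'e, hu'f⟩ := polar (SC_comm M) (mem_cc.mp hxM)
    rw [← mem_cc] at hu'M
    apply hu'0
    have h1 : u' * e' = u' := hu'e e' (by rw [mul_assoc, e'e'])
    have h2 : f' * u' = u' := hu'f f' f's (by rw [← mul_assoc, ← mul_assoc, f'f'])
    have h3 : u' * (star u' * u') = u' := by
      have hi : (star u' * u') * (star u' * u') = star u' * u' := hu'p.2
      have : u' * (1 - star u' * u') = 0 := by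
        apply star_mul_self_zero
        rw [star_mul, star_sub, hu'p.1.star_eq, star_one, mul_assoc, ← mul_assoc (star u'), mul_sub (star u' * u'), hi]
        simp
      rw [mul_sub, mul_one, sub_eq_zero] at this
      exact this.symm
    have h4 : star u * u' = 0 := by rw [← h2, ← mul_assoc, uf', zero_mul]
    have h4' : star u' * u = 0 := by rw [← star_star u, ← star_mul, h4, star_zero]
    have h5 : u' * star u = 0 := by
      have : e' * star u = 0 := by rw [← e's, ← star_mul, ue', star_zero]
      rw [← h1, mul_assoc, this, mul_zero]
    have h5' : u * star u' = 0 := by rw [← star_star u, ← star_mul, h5, star_zero]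
    have h6 : star (u + u') * (u + u') = star u * u + star u' * u' := by
      rw [star_add, add_mul, mul_add, mul_add, h4, h4']; simp
    have h7 : (u + u') * (star u * u + star u' * u') = u + u' := by
      rw [add_mul, mul_add, mul_add, hu1', h3, ← mul_assoc, h5', ← mul_assoc, h5]; simp
    have h8 : f * (u + u') = u + u' := by rw [mul_add, hu2, ← h2, ← mul_assoc, ff']
    have h9 : (u + u') * e = u + u' := by
      rw [add_mul, hu3, ← h1, mul_assoc, e'e]
    have h10 := hmax ⟨u + u', add_mem huM hu'M, by rw [mul_assoc, h6, h7], h8, h9⟩ (by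
      change (u + u') * (star u * u) = u
      rw [add_mul, hu1', ← mul_assoc, h5]; simp)
    change u * (star (u + u') * (u + u')) = u + u' at h10
    rw [h6, mul_add, hu1', ← mul_assoc, h5', zero_mul, add_zero] at h10
    exact left_eq_add.mp h10
  rcases irr_zero M M le_rfl hfac he'M hall with h | h
  · right; rw [hf', sub_eq_zero] at h; exact h.symm
  · left; rw [he', sub_eq_zero] at h; exact h.symm

end part4

section part5

theorem half_step (M : VonNeumannAlgebra H) {x e v : Op H} {C : ℝ} (hC : 0 ≤ C)
    (he : e ∈ M) (hep : IsProjection e) (hxe : x ≤ C • e) (hlow : -(C • (1 : Op H)) ≤ x)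
    (hv : v ∈ M) (hve : star v * v = e) (hev : e * v = 0) :
    ∃ u ∈ M, u * star u = 1 ∧ star u * u = 1 ∧
      -(C • (1 : Op H)) ≤ (1 / 2 : ℝ) • (x + u * x * star u) ∧
      (1 / 2 : ℝ) • (x + u * x * star u) ≤ (C / 2) • (1 : Op H) := by
  have ee : e * e = e := hep.2
  have es : star e = e := hep.1.star_eq
  have hve' : v * e = v := by
    have : v * (1 - e) = 0 := by
      apply star_mul_self_zero
      rw [star_mul, star_sub, es, star_one, mul_assoc, ← mul_assoc (star v), hve, mul_sub, ee]
      simp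
    rw [mul_sub, mul_one, sub_eq_zero] at this
    exact this.symm
  have hsv : star v * e = 0 := by rw [← es, ← star_mul, hev, star_zero]
  have hesv : e * star v = star v := by rw [← es, ← star_mul, hve']
  have hvv : v * v = 0 := by nth_rw 1 [← hve']; rw [mul_assoc, hev, mul_zero]
  have hsvsv : star v * star v = 0 := by rw [← star_mul, hvv, star_zero]
  have hsvM : star v ∈ M := star_mem hv
  set u := v + star v + (1 - e - v * star v) with hu
  have hus : star u = u := by
    simp only [hu, star_add, star_sub, star_mul, star_star, es, star_one]; abel
  have huM : u ∈ M := add_mem (add_mem hv hsvM) (sub_mem (sub_mem (one_mem M) he) (mul_mem hv hsvM))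
  have hue : u * e = v := by
    rw [hu]; simp only [add_mul, sub_mul, ee, hve', hsv, mul_assoc]; simp
  have h1 : v * star v * v = v := by rw [mul_assoc, hve, hve']
  have h2 : star v * v * star v = star v := by rw [hve, hesv]
  have huu : u * u = 1 := by
    have a1 : u * v = e := by
      rw [hu]; simp only [add_mul, sub_mul, hvv, hve, hev, h1]; simp
    have a2 : u * star v = v * star v := by
      rw [hu]; simp only [add_mul, sub_mul, hsvsv, hesv, mul_assoc]; simp
    have a3 : u * (v * star v) = star v := by rw [← mul_assoc, a1, hesv]
    have : u * u = u * v + u * star v + (u - u * e - u * (v * star v)) := by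
      conv_lhs => rw [hu]
      rw [← hu]
      nth_rw 2 [hu]
      simp only [mul_add, mul_sub, mul_one]
    rw [this, a1, a2, a3, hue, hu]; abel
  have hle1 : u * x * star u ≤ C • (v * star v) := by
    refine (star_right_conjugate_le_conjugate hxe u).trans (le_of_eq ?_)
    have : star v = e * star u := by rw [← hue, star_mul, es]
    rw [mul_smul_comm, smul_mul_assoc, this, ← mul_assoc v, ← hue, mul_assoc u e e, ee]
  have hge1 : -(C • (1 : Op H)) ≤ u * x * star u := by
    refine le_trans (le_of_eq ?_) (star_right_conjugate_le_conjugate hlow u)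
    rw [mul_neg, neg_mul, mul_smul_comm, smul_mul_assoc, mul_one, hus, huu]
  have hproj : 0 ≤ 1 - e - v * star v := by
    have : 1 - e - v * star v = star (1 - e - v * star v) * (1 - e - v * star v) := by
      have hevv : e * (v * star v) = 0 := by rw [← mul_assoc, hev, zero_mul]
      have hvve : (v * star v) * e = 0 := by rw [mul_assoc, hsv, mul_zero]
      have hvvvv : (v * star v) * (v * star v) = v * star v := by rw [← mul_assoc, h1]
      simp only [star_sub, star_mul, star_star, es, star_one, mul_sub, sub_mul, ee, hevv, hvve, hvvvv]
      simp
    rw [this]; exact star_mul_self_nonneg _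
  refine ⟨u, huM, by rw [hus, huu], by rw [hus, huu], ?_, ?_⟩
  · rw [← sub_nonneg] at *
    have : (1 / 2 : ℝ) • (x + u * x * star u) - -(C • (1 : Op H)) =
      (1 / 2 : ℝ) • ((x - -(C • 1)) + (u * x * star u - -(C • 1))) := by module
    rw [this]
    exact smul_nonneg (by norm_num) (add_nonneg hlow hge1)
  · rw [← sub_nonneg] at hxe hle1 ⊢
    have : (C / 2) • (1 : Op H) - (1 / 2 : ℝ) • (x + u * x * star u) =
      (1 / 2 : ℝ) • ((C • e - x) + (C • (v * star v) - u * x * star u)) +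
        (C / 2) • (1 - e - v * star v) := by module
    rw [this]
    exact add_nonneg (smul_nonneg (by norm_num) (add_nonneg hxe hle1))
      (smul_nonneg (by linarith) hproj)

theorem dix_step (M : VonNeumannAlgebra H)
    (hfac : relComm (M : Set (Op H)) (M : Set (Op H)) = scalars H) {x : Op H} {C : ℝ} (hC : 0 ≤ C)
    (hx : x ∈ M) (hsa : IsSelfAdjoint x) (hup : x ≤ C • (1 : Op H)) (hlow : -(C • (1 : Op H)) ≤ x) :
    ∃ u ∈ M, u * star u = 1 ∧ star u * u = 1 ∧ ∃ c : ℝ,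
      -((3 / 4 * C) • (1 : Op H)) ≤ (1 / 2 : ℝ) • (x + u * x * star u) - c • (1 : Op H) ∧
      (1 / 2 : ℝ) • (x + u * x * star u) - c • (1 : Op H) ≤ (3 / 4 * C) • (1 : Op H) := by
  have hpM : x⁺ ∈ M := mem_cc.mpr (cent_posPart (mem_cc.mp hx))
  obtain ⟨e, heM, hep, hxe, heb⟩ := supp_exists (SC_comm M) (mem_cc.mp hpM)
  rw [← mem_cc] at heM
  have ee : e * e = e := hep.2
  have es : star e = e := hep.1.star_eq
  have hp0 : 0 ≤ x⁺ := CFC.posPart_nonneg x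
  have hn0 : 0 ≤ x⁻ := CFC.negPart_nonneg x
  have hpn : x⁺ - x⁻ = x := CFC.posPart_sub_negPart x hsa
  have hen : e * x⁻ = 0 := heb _ (CFC.posPart_mul_negPart x)
  have hne : x⁻ * e = 0 := by
    have := congrArg star hen
    rwa [star_mul, es, (IsSelfAdjoint.of_nonneg hn0).star_eq, star_zero] at this
  have hex : e * x⁺ = x⁺ := by
    have := congrArg star hxe
    rwa [star_mul, es, (IsSelfAdjoint.of_nonneg hp0).star_eq] at this
  generalize x⁺ = P at *
  generalize x⁻ = Q at *
  set f := 1 - e with hf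
  have hfM : f ∈ M := sub_mem (one_mem M) heM
  have fs : star f = f := by simp [hf, es]
  have ff : f * f = f := by simp [hf, mul_sub, sub_mul, ee]
  have fe : f * e = 0 := by rw [hf, sub_mul, ee, one_mul, sub_self]
  have ef : e * f = 0 := by rw [hf, mul_sub, ee, mul_one, sub_self]
  have hxp : e * x * e = P := by rw [← hpn, mul_sub, sub_mul, hen, hex, hxe]; simp
  have hxn : f * (-x) * f = Q := by
    have h1 : f * Q = Q := by rw [hf, sub_mul, hen]; simp
    have h2 : Q * f = Q := by rw [hf, mul_sub, hne]; simp
    have h3 : f * P = 0 := by rw [hf, sub_mul, hex]; simp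
    rw [← hpn, neg_sub, mul_sub f, sub_mul _ _ f, h1, h2, h3]; simp
  have hle : x ≤ C • e := by
    have h1 := star_right_conjugate_le_conjugate hup e
    rw [es, hxp, mul_smul_comm, smul_mul_assoc, mul_one, ee] at h1
    refine le_trans ?_ h1
    rw [← sub_nonneg]
    have : P - x = Q := by rw [← hpn]; abel
    rw [this]; exact hn0
  have hle' : -x ≤ C • f := by
    have h0 : -x ≤ C • (1 : Op H) := neg_le.mp hlow
    have h1 := star_right_conjugate_le_conjugate h0 f
    rw [fs, hxn, mul_smul_comm, smul_mul_assoc, mul_one, ff] at h1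
    refine le_trans ?_ h1
    rw [← sub_nonneg]
    have : Q - -x = P := by rw [← hpn]; abel
    rw [this]; exact hp0
  obtain ⟨v, hvM, hv1, hv2, hv3, h⟩ := comparison M hfac heM hep hfM ⟨fs, ff⟩
  rcases h with h | h
  · obtain ⟨u, huM, h1, h2, h3, h4⟩ := half_step M hC heM hep hle hlow hvM h
      (by rw [← hv2, ← mul_assoc, ef, zero_mul])
    refine ⟨u, huM, h1, h2, -(C / 4), ?_, ?_⟩
    · rw [← sub_nonneg] at h3 ⊢
      refine h3.trans (le_of_eq ?_); module
    · rw [← sub_nonneg] at h4 ⊢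
      refine h4.trans (le_of_eq ?_); module
  · obtain ⟨u, huM, h1, h2, h3, h4⟩ := half_step M (x := -x) (e := f) (v := star v) hC hfM ⟨fs, ff⟩
      hle' (neg_le_neg hup) (star_mem hvM) (by rw [star_star]; exact h)
      (by rw [← fs, ← star_mul, ← hv3, mul_assoc, ef, mul_zero, star_zero])
    rw [mul_neg, neg_mul] at h3 h4
    refine ⟨u, huM, h1, h2, (C / 4), ?_, ?_⟩
    · rw [← sub_nonneg] at h4 ⊢
      refine h4.trans (le_of_eq ?_); module
    · rw [← sub_nonneg] at h3 ⊢
      refine h3.trans (le_of_eq ?_); module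

end part5

section part6

theorem tr_nonneg {M : VonNeumannAlgebra H} {τ : Op H →ₗ[ℂ] ℂ}
    (ht : IsTracialState (M : Set (Op H)) τ) {x : Op H} (hx : x ∈ M) (h : 0 ≤ x) : 0 ≤ τ x := by
  have h1 : CFC.sqrt x ∈ M := mem_cc.mpr (cent_sqrt (mem_cc.mp hx))
  have h2 := ht.pos _ h1
  rwa [(IsSelfAdjoint.of_nonneg (CFC.sqrt_nonneg x)).star_eq, CFC.sqrt_mul_sqrt_self x h] at h2

theorem tr_mono {M : VonNeumannAlgebra H} {τ : Op H →ₗ[ℂ] ℂ}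
    (ht : IsTracialState (M : Set (Op H)) τ) {x y : Op H} (hx : x ∈ M) (hy : y ∈ M) (h : x ≤ y) :
    τ x ≤ τ y := by
  have := tr_nonneg ht (sub_mem hy hx) (sub_nonneg.mpr h)
  rw [map_sub, sub_nonneg] at this
  exact this

theorem tr_faithful {M : VonNeumannAlgebra H} {τ : Op H →ₗ[ℂ] ℂ}
    (ht : IsTracialState (M : Set (Op H)) τ) {x : Op H} (hx : x ∈ M) (h : 0 ≤ x) (h0 : τ x = 0) :
    x = 0 := by
  have h1 : CFC.sqrt x ∈ M := mem_cc.mpr (cent_sqrt (mem_cc.mp hx))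
  have h2 := ht.faithful _ h1
  have h3 := CFC.sqrt_mul_sqrt_self x h
  rw [(IsSelfAdjoint.of_nonneg (CFC.sqrt_nonneg x)).star_eq, h3] at h2
  rw [← h3, h2 h0, mul_zero]

theorem tr_rsmul (τ : Op H →ₗ[ℂ] ℂ) (c : ℝ) (x : Op H) : τ (c • x) = c * τ x := by
  have : c • x = (c : ℂ) • x := by simp
  rw [this, map_smul, smul_eq_mul]

theorem tr_pos {M : VonNeumannAlgebra H} {τ : Op H →ₗ[ℂ] ℂ}
    (ht : IsTracialState (M : Set (Op H)) τ) {x : Op H} (hx : x ∈ M) (h : 0 ≤ x) (h0 : x ≠ 0) :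
    0 < (τ x).re ∧ τ x = ((τ x).re : ℂ) := by
  have h1 := tr_nonneg ht hx h
  have h2 : τ x ≠ 0 := fun h' => h0 (tr_faithful ht hx h h')
  have h3 := Complex.le_def.mp h1
  have h4 : τ x = ((τ x).re : ℂ) := by
    apply Complex.ext
    · simp
    · simpa using h3.2.symm
  refine ⟨lt_of_le_of_ne h3.1 ?_, h4⟩
  intro h5
  apply h2
  rw [h4, ← h5]; simp

theorem dix_iter {M : VonNeumannAlgebra H} {τ : Op H →ₗ[ℂ] ℂ} (hM : IsII1Factor M τ) {k : Op H}
    (hk : k ∈ M) (hk0 : 0 ≤ k) (n : ℕ) : ∃ (ι : Type) (_ : Fintype ι) (m : ι → Op H),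
      (∀ i, m i ∈ M) ∧ τ (∑ i, m i * k * star (m i)) = τ k ∧ ∃ c : ℝ,
      -(((3 / 4) ^ n * ‖k‖) • (1 : Op H)) ≤ ∑ i, m i * k * star (m i) - c • (1 : Op H) ∧
      ∑ i, m i * k * star (m i) - c • (1 : Op H) ≤ ((3 / 4) ^ n * ‖k‖) • (1 : Op H) := by
  have hksa := IsSelfAdjoint.of_nonneg hk0
  induction n with
  | zero =>
    refine ⟨Unit, inferInstance, fun _ => 1, fun _ => one_mem M, by simp, 0, ?_, ?_⟩
    · have := hksa.neg_algebraMap_norm_le_self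
      simpa [Algebra.algebraMap_eq_smul_one] using this
    · have := hksa.le_algebraMap_norm_self
      simpa [Algebra.algebraMap_eq_smul_one] using this
  | succ n ih =>
    obtain ⟨ι, _, m, hm, htr, c, h1, h2⟩ := ih
    set y := ∑ i, m i * k * star (m i) with hy
    have hyM : y ∈ M := sum_mem fun i _ => mul_mem (mul_mem (hm i) hk) (star_mem (hm i))
    have hysa : IsSelfAdjoint y := by
      apply isSelfAdjoint_sum
      intro i _
      rw [isSelfAdjoint_iff]
      simp [mul_assoc, hksa.star_eq]
    have hcsa : IsSelfAdjoint (c • (1 : Op H)) := by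
      rw [isSelfAdjoint_iff]; simp
    obtain ⟨u, huM, hu1, hu2, d, h3, h4⟩ := dix_step M hM.factor (C := (3 / 4) ^ n * ‖k‖)
      (by positivity) (sub_mem hyM (rsmul_memM c (one_mem M))) (hysa.sub hcsa) h2 h1
    let s : ℝ := √(1 / 2)
    have hs : s * s = 1 / 2 := Real.mul_self_sqrt (by norm_num)
    let m' : ι ⊕ ι → Op H := Sum.elim (fun i => s • m i) (fun i => s • (u * m i))
    have hsum : ∑ i, m' i * k * star (m' i) = (1 / 2 : ℝ) • (y + u * y * star u) := by
      rw [Fintype.sum_sum_type]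
      simp only [m', Sum.elim_inl, Sum.elim_inr, star_smul, star_mul, smul_mul_assoc, mul_smul_comm,
        smul_smul, star_trivial, hs]
      rw [← Finset.smul_sum, ← Finset.smul_sum, smul_add, hy, Finset.mul_sum, Finset.sum_mul]
      simp only [mul_assoc]
    refine ⟨ι ⊕ ι, inferInstance, m', ?_, ?_, c + d, ?_⟩
    · rintro (i | i)
      · exact rsmul_memM _ (hm i)
      · exact rsmul_memM _ (mul_mem huM (hm i))
    · rw [hsum, tr_rsmul, map_add, mul_assoc, hM.trace.tracial _ huM _ (mul_mem hyM (star_mem huM)),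
        mul_assoc, hu2, mul_one, htr]
      push_cast; ring
    · have e1 : (1 / 2 : ℝ) • (y - c • (1 : Op H) + u * (y - c • (1 : Op H)) * star u) - d • (1 : Op H) =
          (1 / 2 : ℝ) • (y + u * y * star u) - (c + d) • (1 : Op H) := by
        rw [mul_sub, sub_mul, mul_smul_comm, smul_mul_assoc, mul_one, hu1]; module
      rw [e1] at h3 h4
      rw [hsum, pow_succ, mul_comm ((3 / 4 : ℝ) ^ n) (3 / 4), mul_assoc]
      exact ⟨h3, h4⟩

theorem simple {M : VonNeumannAlgebra H} {τ : Op H →ₗ[ℂ] ℂ} (hM : IsII1Factor M τ) {k : Op H}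
    (hk : k ∈ M) (hk0 : 0 ≤ k) (hkne : k ≠ 0) : ∃ (ι : Type) (_ : Fintype ι) (m : ι → Op H),
      (∀ i, m i ∈ M) ∧ ∑ i, m i * k * star (m i) = 1 := by
  have ht := hM.trace
  obtain ⟨htp, hte⟩ := tr_pos ht hk hk0 hkne
  set t := (τ k).re with htdef
  obtain ⟨n, hn⟩ : ∃ n : ℕ, (3 / 4 : ℝ) ^ n * ‖k‖ < t / 4 := by
    have h1 : Tendsto (fun n : ℕ => (3 / 4 : ℝ) ^ n * ‖k‖) atTop (nhds 0) := by
      simpa using (tendsto_pow_atTop_nhds_zero_of_lt_one (r := (3 / 4 : ℝ)) (by norm_num)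
        (by norm_num)).mul_const ‖k‖
    exact (h1.eventually (gt_mem_nhds (by linarith))).exists
  obtain ⟨ι, _, m, hm, htr, c, h1, h2⟩ := dix_iter hM hk hk0 n
  set y := ∑ i, m i * k * star (m i) with hy
  have hyM : y ∈ M := sum_mem fun i _ => mul_mem (mul_mem (hm i) hk) (star_mem (hm i))
  set ε := (3 / 4 : ℝ) ^ n * ‖k‖ with hε
  have hc : t - c ≤ ε := by
    have := tr_mono ht (sub_mem hyM (rsmul_memM c (one_mem M))) (rsmul_memM ε (one_mem M)) h2
    rw [map_sub, tr_rsmul, tr_rsmul, ht.map_one, htr, hte] at this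
    have := (Complex.le_def.mp this).1
    simpa using this
  have hy1 : (t / 2) • (1 : Op H) ≤ y := by
    rw [← sub_nonneg] at h1 ⊢
    have : y - (t / 2) • (1 : Op H) = (y - c • 1 - -(ε • 1)) + (c - ε - t / 2) • (1 : Op H) := by module
    rw [this]
    exact add_nonneg h1 (smul_nonneg (by linarith) zero_le_one)
  set z := (2 / t) • y with hz
  have hz1 : 1 ≤ z := by
    have := smul_le_smul_of_nonneg_left hy1 (show 0 ≤ 2 / t by positivity)
    rw [smul_smul] at this
    have h3 : 2 / t * (t / 2) = 1 := by field_simp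
    rwa [h3, one_smul] at this
  have hzM : z ∈ M := rsmul_memM _ hyM
  have hzsa : IsSelfAdjoint z := IsSelfAdjoint.of_nonneg (zero_le_one.trans hz1)
  have hspec := (CFC.one_le_iff (R := ℝ) z hzsa).mp hz1
  let F : ℝ → ℝ := fun t => (√(max t 1))⁻¹
  have hF : Continuous F := by
    apply Continuous.inv₀ (by fun_prop)
    intro t
    have : 0 < max t 1 := lt_of_lt_of_le one_pos (le_max_right t 1)
    positivity
  let s := cfc F z
  have hsM : s ∈ M := mem_cc.mpr (cent_real (mem_cc.mp hzM) F)
  have hssa : IsSelfAdjoint s := cfc_predicate F z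
  have hszs : s * z * s = 1 := by
    have h3 : s * z = cfc (fun t => F t * t) z := by
      rw [cfc_mul F (fun t : ℝ => t) z hF.continuousOn (by fun_prop), cfc_id' ℝ z]
    have h4 : s * z * s = cfc (fun t => F t * t * F t) z := by
      rw [h3, cfc_mul (fun t : ℝ => F t * t) F z (by fun_prop) hF.continuousOn]
    rw [h4, ← cfc_const_one ℝ z]
    apply cfc_congr
    intro t ht
    have := hspec t ht
    simp only [F, max_eq_left this]
    have h5 : √t * √t = t := Real.mul_self_sqrt (by linarith)
    have h6 : 0 < √t := Real.sqrt_pos.mpr (by linarith)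
    field_simp
    rw [sq, h5]
  have hsq : √(2 / t) * √(2 / t) = 2 / t := Real.mul_self_sqrt (by positivity)
  refine ⟨ι, inferInstance, fun i => √(2 / t) • (s * m i), fun i => rsmul_memM _ (mul_mem hsM (hm i)), ?_⟩
  rw [← hszs, hz, hy]
  simp only [star_smul, star_mul, smul_mul_assoc, mul_smul_comm, smul_smul, star_trivial, hsq,
    hssa.star_eq, Finset.mul_sum, Finset.sum_mul, Finset.smul_sum, mul_assoc]

end part6

section part7

theorem tr_sa {M : VonNeumannAlgebra H} {τ : Op H →ₗ[ℂ] ℂ}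
    (ht : IsTracialState (M : Set (Op H)) τ) {x : Op H} (hx : x ∈ M) (hsa : IsSelfAdjoint x) :
    (τ x).im = 0 := by
  have hp := tr_nonneg ht (mem_cc.mpr (cent_posPart (mem_cc.mp hx))) (CFC.posPart_nonneg x)
  have hn := tr_nonneg ht (mem_cc.mpr (cent_negPart (mem_cc.mp hx))) (CFC.negPart_nonneg x)
  rw [← CFC.posPart_sub_negPart x hsa, map_sub, Complex.sub_im]
  have h1 := (Complex.le_def.mp hp).2
  have h2 := (Complex.le_def.mp hn).2
  simp only [Complex.zero_im] at h1 h2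
  rw [← h1, ← h2, sub_zero]

theorem tr_star {M : VonNeumannAlgebra H} {τ : Op H →ₗ[ℂ] ℂ}
    (ht : IsTracialState (M : Set (Op H)) τ) {x : Op H} (hx : x ∈ M) :
    τ (star x) = starRingEnd ℂ (τ x) := by
  have h1 : (τ (x + star x)).im = 0 := tr_sa ht (add_mem hx (star_mem hx)) (by
    rw [isSelfAdjoint_iff]; simp [add_comm])
  have h2 : (τ (Complex.I • (x - star x))).im = 0 :=
    tr_sa ht (smul_memM _ (sub_mem hx (star_mem hx))) (by
      rw [isSelfAdjoint_iff]; simp [smul_sub]; abel)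
  rw [map_add, Complex.add_im] at h1
  rw [map_smul, map_sub, smul_eq_mul, Complex.mul_im] at h2
  simp at h2
  apply Complex.ext
  · simp; linarith
  · simp; linarith

theorem tr_CS {M : VonNeumannAlgebra H} {τ : Op H →ₗ[ℂ] ℂ}
    (ht : IsTracialState (M : Set (Op H)) τ) {x y : Op H} (hx : x ∈ M) (hy : y ∈ M) :
    ‖τ (star x * y)‖ ^ 2 ≤ (τ (star x * x)).re * (τ (star y * y)).re := by
  let V := M.toStarSubalgebra
  let c : PreInnerProductSpace.Core ℂ V :=
    { inner := fun a b => τ (star a.1 * b.1)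
      conj_inner_symm := fun a b => by
        rw [← tr_star ht (mul_mem (star_mem b.2) a.2)]
        simp
      re_inner_nonneg := fun a => by
        exact (Complex.le_def.mp (ht.pos a.1 a.2)).1
      add_left := fun a b d => by
        simp [add_mul]
      smul_left := fun a b r => by
        simp }
  have := @InnerProductSpace.Core.inner_mul_inner_self_le ℂ V _ _ _ c ⟨x, hx⟩ ⟨y, hy⟩
  change ‖τ (star x * y)‖ * ‖τ (star y * x)‖ ≤ (τ (star x * x)).re * (τ (star y * y)).re at this
  have h2 : τ (star y * x) = starRingEnd ℂ (τ (star x * y)) := by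
    rw [← tr_star ht (mul_mem (star_mem hx) hy)]; simp
  rw [h2, RCLike.norm_conj] at this
  rw [sq]; exact this

theorem riesz_factor {V : Type*} [AddCommGroup V] [Module ℂ V] (L : V →ₗ[ℂ] H) (f : V →ₗ[ℂ] ℂ)
    (C : ℝ) (h : ∀ v, ‖f v‖ ≤ C * ‖L v‖) : ∃ ζ : H, ∀ v, f v = inner ℂ ζ (L v) := by
  have hker : LinearMap.ker L ≤ LinearMap.ker f := by
    intro v hv
    rw [LinearMap.mem_ker] at *
    have := h v
    rw [hv, norm_zero, mul_zero] at this
    exact norm_le_zero_iff.mp this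
  let g : LinearMap.range L →ₗ[ℂ] ℂ := ((LinearMap.ker L).liftQ f hker) ∘ₗ L.quotKerEquivRange.symm
  have hg : ∀ v, g ⟨L v, LinearMap.mem_range_self L v⟩ = f v := by
    intro v
    have : L.quotKerEquivRange.symm ⟨L v, LinearMap.mem_range_self L v⟩ = (LinearMap.ker L).mkQ v := by
      rw [LinearEquiv.symm_apply_eq]
      rfl
    simp only [g, LinearMap.comp_apply, LinearEquiv.coe_coe, this]
    rfl
  have hgb : ∀ x : LinearMap.range L, ‖g x‖ ≤ C * ‖x‖ := by
    rintro ⟨_, v, rfl⟩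
    rw [hg]; exact h v
  obtain ⟨G, hG, -⟩ := exists_extension_norm_eq (LinearMap.range L) (g.mkContinuous C hgb)
  refine ⟨(InnerProductSpace.toDual ℂ H).symm G, fun v => ?_⟩
  rw [InnerProductSpace.toDual_symm_apply]
  have := hG ⟨L v, LinearMap.mem_range_self L v⟩
  rw [this]
  simp [hg]

theorem lim_ge {ι : Type*} {U : Ultrafilter ι} {x : ι → Op H} {X : Op H}
    (hX : ∀ ξ η : H, Tendsto (fun i => inner ℂ (x i η) ξ) U (nhds (inner ℂ (X η) ξ)))
    (b : Op H) (h : ∀ᶠ i in (U : Filter ι), b ≤ x i) : b ≤ X := by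
  rw [le_iff_inner]
  intro ξ
  refine ge_of_tendsto (hX ξ ξ) ?_
  filter_upwards [h] with i hi
  exact (le_iff_inner _ _).mp hi ξ

theorem lim_le {ι : Type*} {U : Ultrafilter ι} {x : ι → Op H} {X : Op H}
    (hX : ∀ ξ η : H, Tendsto (fun i => inner ℂ (x i η) ξ) U (nhds (inner ℂ (X η) ξ)))
    (b : Op H) (h : ∀ᶠ i in (U : Filter ι), x i ≤ b) : X ≤ b := by
  rw [le_iff_inner]
  intro ξ
  refine le_of_tendsto (hX ξ ξ) ?_
  filter_upwards [h] with i hi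
  exact (le_iff_inner _ _).mp hi ξ

theorem norm_le_one {x : Op H} (h0 : 0 ≤ x) (h1 : x ≤ 1) : ‖x‖ ≤ 1 :=
  (CStarAlgebra.norm_le_one_iff_of_nonneg x h0).mpr h1

theorem exists_k {M : VonNeumannAlgebra H} {τ : Op H →ₗ[ℂ] ℂ}
    (ht : IsTracialState (M : Set (Op H)) τ) : ∃ k ∈ M, 0 ≤ k ∧ k ≠ 0 ∧ ∃ ξ : H,
      ∀ x ∈ M, 0 ≤ x → x ≤ k → (τ x).re ≤ 2 * (inner ℂ (x ξ) ξ).re := by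
  have hnt : (1 : Op H) ≠ 0 := by
    intro h
    have := ht.map_one
    rw [h, map_zero] at this
    exact zero_ne_one this
  obtain ⟨ξ0, hξ0⟩ : ∃ ξ : H, ξ ≠ 0 := by
    by_contra hcon
    push Not at hcon
    apply hnt
    ext ξ
    rw [hcon ξ]; simp
  obtain ⟨ξ, hξ⟩ : ∃ ξ : H, ‖ξ‖ = 1 := ⟨((‖ξ0‖ : ℂ)⁻¹) • ξ0, by
    rw [norm_smul]; simp [hξ0]⟩
  let Z := {h : Op H // h ∈ M ∧ 0 ≤ h ∧ h ≤ 1 ∧ 2 * (inner ℂ (h ξ) ξ).re ≤ (τ h).re}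
  let r : Z → Z → Prop := fun a b => a.1 ≤ b.1
  have hrefl : ∀ a, r a a := fun a => le_refl a.1
  have htrans : ∀ a b c, r a b → r b c → r a c := fun a b c h1 h2 => le_trans (a := a.1) h1 h2
  have hch : ∀ c : Set Z, IsChain r c → ∃ ub, ∀ a ∈ c, r a ub := by
    intro c hc
    rcases c.eq_empty_or_nonempty with h0 | hne
    · refine ⟨⟨0, zero_mem M, le_refl _, zero_le_one, by simp⟩, ?_⟩
      intro a ha; rw [h0] at ha; exact ha.elim
    obtain ⟨U, hU⟩ := chain_ultra r hrefl htrans c hc hne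
    let x : c → Op H := fun i => i.1.1
    obtain ⟨w, hw⟩ := ultralimit U x 1 (fun i => norm_le_one i.1.2.2.1 i.1.2.2.2.1)
    have hwM : w ∈ M := mem_cc.mpr (ultralimit_mem U x (fun i => mem_cc.mp i.1.2.1) hw)
    have hwi : ∀ i : c, x i ≤ w := fun i => lim_ge hw _ (hU i)
    refine ⟨⟨w, hwM, lim_ge hw _ (Eventually.of_forall fun i => i.1.2.2.1),
      lim_le hw _ (Eventually.of_forall fun i => i.1.2.2.2.1), ?_⟩, fun a ha => hwi ⟨a, ha⟩⟩
    have h1 : Tendsto (fun i => 2 * (inner ℂ (x i ξ) ξ).re) U (nhds (2 * (inner ℂ (w ξ) ξ).re)) :=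
      ((Complex.continuous_re.tendsto _).comp (hw ξ ξ)).const_mul 2
    refine le_of_tendsto h1 (Eventually.of_forall fun i => ?_)
    exact i.1.2.2.2.2.trans (Complex.le_def.mp (tr_mono ht i.1.2.1 hwM (hwi i))).1
  obtain ⟨⟨h, hhM, hh0, hh1, hhω⟩, hmax⟩ := exists_maximal_of_chains_bounded hch (htrans _ _ _)
  refine ⟨1 - h, sub_mem (one_mem M) hhM, sub_nonneg.mpr hh1, ?_, ξ, ?_⟩
  · intro h0
    rw [sub_eq_zero] at h0
    rw [← h0, ht.map_one] at hhω
    simp [hξ] at hhω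
  · intro x hx hx0 hxk
    by_contra hcon
    push Not at hcon
    have hm := hmax ⟨h + x, add_mem hhM hx, add_nonneg hh0 hx0, by
      rw [add_comm]; exact le_sub_iff_add_le.mp hxk, by
      simp only [map_add, add_apply, inner_add_left, Complex.add_re]
      linarith⟩ (le_add_of_nonneg_right hx0)
    change h + x ≤ h at hm
    have hx00 : x = 0 := le_antisymm (by simpa using hm) hx0
    rw [hx00] at hcon
    simp at hcon

theorem normal {M : VonNeumannAlgebra H} {τ : Op H →ₗ[ℂ] ℂ} (hM : IsII1Factor M τ) :
    ∃ (ι : Type) (_ : Fintype ι) (a b : ι → H), ∀ y ∈ M, τ y = ∑ i, inner ℂ (a i) (y (b i)) := by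
  have ht := hM.trace
  obtain ⟨k, hkM, hk0, hkne, ξ, hkx⟩ := exists_k ht
  obtain ⟨ι, _, m, hm, hsum⟩ := simple hM hkM hk0 hkne
  set s := CFC.sqrt k with hs
  have hs0 : 0 ≤ s := CFC.sqrt_nonneg k
  have hss : s * s = k := CFC.sqrt_mul_sqrt_self k hk0
  have hssa : star s = s := IsSelfAdjoint.of_nonneg hs0
  have hsM : s ∈ M := mem_cc.mpr (cent_sqrt (mem_cc.mp hkM))
  have hbd : ∀ y ∈ M, (τ (star (y * s) * (y * s))).re ≤ 2 * ‖y (s ξ)‖ ^ 2 := by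
    intro y hy
    set c : ℝ := 1 / (‖y‖ ^ 2 + 1) with hc
    have hc0 : 0 < c := by positivity
    have hA : star (y * s) * (y * s) ∈ M := mul_mem (star_mem (mul_mem hy hsM)) (mul_mem hy hsM)
    have h1 : c • (star (y * s) * (y * s)) ≤ k := by
      have h2 : star y * y ≤ (‖y‖ ^ 2 + 1) • (1 : Op H) := by
        have := CStarAlgebra.star_mul_le_algebraMap_norm_sq (a := y)
        rw [Algebra.algebraMap_eq_smul_one] at this
        refine this.trans ?_
        exact SMulPosMono.smul_le_smul_of_nonneg_right zero_le_one (by linarith)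
      have h3 := star_left_conjugate_le_conjugate h2 s
      rw [mul_smul_comm, smul_mul_assoc, mul_one, hssa, hss] at h3
      have h4 := smul_le_smul_of_nonneg_left h3 hc0.le
      rw [smul_smul] at h4
      have h5 : c * (‖y‖ ^ 2 + 1) = 1 := by rw [hc]; field_simp
      rw [h5, one_smul] at h4
      simpa only [star_mul, hssa, mul_assoc] using h4
    have h2 := hkx _ (rsmul_memM c hA) (smul_nonneg hc0.le (star_mul_self_nonneg _)) h1
    rw [tr_rsmul] at h2
    have h3 : inner ℂ ((c • (star (y * s) * (y * s))) ξ) ξ = (c : ℂ) * (‖y (s ξ)‖ ^ 2 : ℝ) := by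
      have : (c • (star (y * s) * (y * s))) ξ = (c : ℂ) • (star (y * s)) ((y * s) ξ) := by
        simp
      rw [this, inner_smul_left, inner_star_left, opmul]
      simp
    rw [h3] at h2
    simp only [Complex.re_ofReal_mul, Complex.ofReal_re] at h2
    nlinarith
  let V := M.toStarSubalgebra
  let L : V →ₗ[ℂ] H :=
    { toFun := fun y => y.1 (s ξ)
      map_add' := fun a b => by simp
      map_smul' := fun c a => by simp }
  let f : V →ₗ[ℂ] ℂ :=
    { toFun := fun y => τ (s * (y.1 * s))
      map_add' := fun a b => by simp [add_mul, mul_add]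
      map_smul' := fun c a => by simp }
  have hf : ∀ y, ‖f y‖ ≤ √(2 * (τ k).re) * ‖L y‖ := by
    intro y
    change ‖τ (s * (y.1 * s))‖ ≤ √(2 * (τ k).re) * ‖y.1 (s ξ)‖
    have h1 := tr_CS ht hsM (mul_mem y.2 hsM)
    have h2 := hbd y.1 y.2
    rw [hssa, hss] at h1
    have h3 : 0 ≤ (τ k).re := (Complex.le_def.mp (tr_nonneg ht hkM hk0)).1
    rw [← Real.sqrt_sq (norm_nonneg (y.1 (s ξ))), ← Real.sqrt_mul (by positivity)]
    apply Real.le_sqrt_of_sq_le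
    refine h1.trans ?_
    nlinarith
  obtain ⟨ζ, hζ⟩ := riesz_factor L f _ hf
  refine ⟨ι, inferInstance, fun i => m i ζ, fun i => m i (s ξ), fun y hy => ?_⟩
  have h1 : τ y = ∑ i, τ (s * ((star (m i) * y * m i) * s)) := by
    calc τ y = τ (y * ∑ i, m i * k * star (m i)) := by rw [hsum, mul_one]
      _ = ∑ i, τ ((y * m i * s) * (s * star (m i))) := by
        rw [Finset.mul_sum, map_sum]
        refine Finset.sum_congr rfl fun i _ => ?_
        rw [← hss]; simp only [mul_assoc]
      _ = _ := by
        refine Finset.sum_congr rfl fun i _ => ?_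
        rw [ht.tracial _ (mul_mem (mul_mem hy (hm i)) hsM) _ (mul_mem hsM (star_mem (hm i)))]
        simp only [mul_assoc]
  rw [h1]
  refine Finset.sum_congr rfl fun i _ => ?_
  have := hζ ⟨star (m i) * y * m i, mul_mem (mul_mem (star_mem (hm i)) hy) (hm i)⟩
  change τ (s * ((star (m i) * y * m i) * s)) = inner ℂ ζ ((star (m i) * y * m i) (s ξ)) at this
  rw [this, opmul, opmul, inner_star_right]

theorem tr_lim {M : VonNeumannAlgebra H} {τ : Op H →ₗ[ℂ] ℂ} (hM : IsII1Factor M τ)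
    {ι : Type*} {U : Ultrafilter ι} {x : ι → Op H} {X : Op H}
    (hX : ∀ ξ η : H, Tendsto (fun i => inner ℂ (x i η) ξ) U (nhds (inner ℂ (X η) ξ)))
    (hx : ∀ i, x i ∈ M) : Tendsto (fun i => τ (x i)) U (nhds (τ X)) := by
  obtain ⟨κ, _, a, b, hτ⟩ := normal hM
  have hXM : X ∈ M := mem_cc.mpr (ultralimit_mem U x (fun i => mem_cc.mp (hx i)) hX)
  rw [hτ X hXM]
  refine Tendsto.congr (fun i => (hτ _ (hx i)).symm) ?_
  refine tendsto_finsetSum _ fun j _ => ?_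
  have h := (Complex.continuous_conj.tendsto _).comp (hX (a j) (b j))
  rw [inner_conj_symm] at h
  refine h.congr fun i => ?_
  simp only [Function.comp]
  rw [inner_conj_symm]

end part7

section part8

theorem sa_ind {N : VonNeumannAlgebra H} (P : Op H → Prop) (hadd : ∀ a b, P a → P b → P (a + b))
    (hsmul : ∀ (c : ℂ) a, P a → P (c • a)) (hsa : ∀ a ∈ N, IsSelfAdjoint a → P a) :
    ∀ a ∈ N, P a := by
  intro a ha
  have h1 : P (a + star a) := hsa _ (add_mem ha (star_mem ha)) (by
    rw [isSelfAdjoint_iff]; simp [add_comm])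
  have h2 : P (Complex.I • (a - star a)) :=
    hsa _ (smul_memM _ (sub_mem ha (star_mem ha))) (by
      rw [isSelfAdjoint_iff]; simp [smul_sub]; abel)
  have h3 : a = (1 / 2 : ℂ) • (a + star a) + (-(Complex.I) / 2) • (Complex.I • (a - star a)) := by
    rw [smul_smul]
    have : -(Complex.I) / 2 * Complex.I = 1 / 2 := by
      rw [div_mul_eq_mul_div, neg_mul, Complex.I_mul_I, neg_neg]
    rw [this]; module
  rw [h3]
  exact hadd _ _ (hsmul _ _ h1) (hsmul _ _ h2)

theorem tr_mul_nonneg {M : VonNeumannAlgebra H} {τ : Op H →ₗ[ℂ] ℂ}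
    (ht : IsTracialState (M : Set (Op H)) τ) {x y : Op H} (hx : x ∈ M) (hy : y ∈ M)
    (h : 0 ≤ x) (h' : 0 ≤ y) : 0 ≤ τ (x * y) := by
  have hsM : CFC.sqrt x ∈ M := mem_cc.mpr (cent_sqrt (mem_cc.mp hx))
  have hss := CFC.sqrt_mul_sqrt_self x h
  have hssa : star (CFC.sqrt x) = CFC.sqrt x := IsSelfAdjoint.of_nonneg (CFC.sqrt_nonneg x)
  rw [← hss, mul_assoc, ht.tracial _ hsM _ (mul_mem hsM hy)]
  refine tr_nonneg ht (mul_mem (mul_mem hsM hy) hsM) ?_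
  have := star_left_conjugate_nonneg h' (CFC.sqrt x)
  rwa [hssa] at this

theorem clamp {N : VonNeumannAlgebra H} {y : Op H} (hy : y ∈ N) (hsa : IsSelfAdjoint y) :
    ∃ a ∈ N, ∃ b ∈ N, ∃ c ∈ N, 0 ≤ a ∧ 0 ≤ b ∧ 0 ≤ c ∧ c ≤ 1 ∧ y = c + b - a ∧ c * b = b ∧ c * a = 0 := by
  have hm := fun F : ℝ → ℝ => (mem_cc (M := N)).mpr (cent_real (mem_cc.mp hy) F)
  refine ⟨cfc (fun t : ℝ => max (-t) 0) y, hm _, cfc (fun t : ℝ => max (t - 1) 0) y, hm _,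
    cfc (fun t : ℝ => max (min t 1) 0) y, hm _, ?_, ?_, ?_, ?_, ?_, ?_, ?_⟩
  · exact cfc_nonneg fun t _ => le_max_right _ _
  · exact cfc_nonneg fun t _ => le_max_right _ _
  · exact cfc_nonneg fun t _ => le_max_right _ _
  · exact cfc_le_one _ _ fun t _ => max_le (min_le_right _ _) zero_le_one
  · rw [← cfc_add y (fun t : ℝ => max (min t 1) 0) (fun t : ℝ => max (t - 1) 0),
      ← cfc_sub (fun t : ℝ => max (min t 1) 0 + max (t - 1) 0) (fun t : ℝ => max (-t) 0) y]
    nth_rw 1 [← cfc_id' ℝ y]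
    apply cfc_congr
    intro t _
    rcases le_total t 0 with h | h
    · simp only
      rw [min_eq_left (by linarith), max_eq_right h, max_eq_right (by linarith), max_eq_left (by linarith)]
      ring
    · rcases le_total t 1 with h1 | h1
      · simp only
        rw [min_eq_left h1, max_eq_left h, max_eq_right (by linarith), max_eq_right (by linarith)]
        ring
      · simp only
        rw [min_eq_right h1, max_eq_left zero_le_one, max_eq_left (by linarith), max_eq_right (by linarith)]
        ring
  · rw [← cfc_mul (fun t : ℝ => max (min t 1) 0) (fun t : ℝ => max (t - 1) 0) y]
    apply cfc_congr
    intro t _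
    rcases le_total t 1 with h1 | h1
    · simp only
      rw [max_eq_right (a := t - 1) (by linarith)]; simp
    · simp only
      rw [min_eq_right h1, max_eq_left zero_le_one]; simp
  · rw [← cfc_mul (fun t : ℝ => max (min t 1) 0) (fun t : ℝ => max (-t) 0) y, ← cfc_const_zero ℝ y]
    apply cfc_congr
    intro t _
    rcases le_total t 0 with h | h
    · simp only
      rw [min_eq_left (by linarith), max_eq_right h]; simp
    · simp only
      rw [max_eq_right (a := -t) (by linarith)]; simp

theorem clamp_le {M N : VonNeumannAlgebra H} {τ : Op H →ₗ[ℂ] ℂ}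
    (ht : IsTracialState (M : Set (Op H)) τ) (hNM : (N : Set (Op H)) ⊆ (M : Set (Op H)))
    {z y : Op H} (hz : z ∈ M) (hz0 : 0 ≤ z) (hz1 : z ≤ 1) (hy : y ∈ N) (hsa : IsSelfAdjoint y) :
    ∃ c ∈ N, 0 ≤ c ∧ c ≤ 1 ∧ (τ ((z - c) * (z - c))).re ≤ (τ ((z - y) * (z - y))).re := by
  obtain ⟨a, ha, b, hb, c, hc, ha0, hb0, hc0, hc1, hyy, hcb, hca⟩ := clamp hy hsa
  refine ⟨c, hc, hc0, hc1, ?_⟩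
  have haM : a ∈ M := hNM ha
  have hbM : b ∈ M := hNM hb
  have hcM : c ∈ M := hNM hc
  have h1 : (z - y) * (z - y) = (z - c) * (z - c) - (z - c) * (b - a) - (b - a) * (z - c)
      + star (b - a) * (b - a) := by
    rw [star_sub, (IsSelfAdjoint.of_nonneg ha0).star_eq, (IsSelfAdjoint.of_nonneg hb0).star_eq, hyy]
    noncomm_ring
  have h2 : (z - c) * (b - a) = -((1 - z) * b) - z * a := by
    have : (z - c) * (b - a) = z * b - z * a - c * b + c * a := by noncomm_ring
    rw [this, hcb, hca]; noncomm_ring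
  rw [h1, map_add, map_sub, map_sub,
    ht.tracial _ (sub_mem hbM haM) _ (sub_mem hz hcM), h2, map_sub, map_neg]
  have p1 := (Complex.le_def.mp (ht.pos _ (sub_mem hbM haM))).1
  have p2 := (Complex.le_def.mp (tr_mul_nonneg ht (sub_mem (one_mem M) hz) hbM (sub_nonneg.mpr hz1) hb0)).1
  have p3 := (Complex.le_def.mp (tr_mul_nonneg ht hz haM hz0 ha0)).1
  simp only [Complex.zero_re, Complex.add_re, Complex.sub_re, Complex.neg_re] at *
  linarith

theorem ce_min {M N : VonNeumannAlgebra H} {τ : Op H →ₗ[ℂ] ℂ} (hM : IsII1Factor M τ)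
    (hNM : (N : Set (Op H)) ⊆ (M : Set (Op H)))
    {z : Op H} (hz : z ∈ M) (hz0 : 0 ≤ z) :
    ∃ h ∈ N, 0 ≤ h ∧ h ≤ 1 ∧ ∀ c ∈ N, 0 ≤ c → c ≤ 1 →
      (τ ((z - h) * (z - h))).re ≤ (τ ((z - c) * (z - c))).re := by
  have ht := hM.trace
  let D : Set ℝ := {d | ∃ c ∈ N, 0 ≤ c ∧ c ≤ 1 ∧ d = (τ ((z - c) * (z - c))).re}
  have hzs : star z = z := IsSelfAdjoint.of_nonneg hz0
  have hsas : ∀ c ∈ N, 0 ≤ c → 0 ≤ τ ((z - c) * (z - c)) := by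
    intro c hc hc0
    have := ht.pos _ (sub_mem hz (hNM hc))
    rwa [star_sub, hzs, (IsSelfAdjoint.of_nonneg hc0).star_eq] at this
  have hD0 : ∀ d ∈ D, 0 ≤ d := by
    rintro d ⟨c, hc, hc0, hc1, rfl⟩
    exact (Complex.le_def.mp (hsas c hc hc0)).1
  have hDb : BddBelow D := ⟨0, hD0⟩
  have hDne : D.Nonempty := ⟨_, 0, zero_mem N, le_refl _, zero_le_one, rfl⟩
  set d := sInf D with hd
  have hd0 : 0 ≤ d := le_csInf hDne hD0
  have hseq : ∀ n : ℕ, ∃ c ∈ N, 0 ≤ c ∧ c ≤ 1 ∧ (τ ((z - c) * (z - c))).re < d + 1 / ((n : ℝ) + 1) := by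
    intro n
    have : d < d + 1 / ((n : ℝ) + 1) := by
      have : (0 : ℝ) < 1 / ((n : ℝ) + 1) := Nat.one_div_pos_of_nat
      linarith
    obtain ⟨_, ⟨c, hc, hc0, hc1, rfl⟩, h2⟩ := exists_lt_of_csInf_lt hDne this
    exact ⟨c, hc, hc0, hc1, h2⟩
  choose x hxN hx0 hx1 hxd using hseq
  let U : Ultrafilter ℕ := Ultrafilter.of atTop
  have hU : (U : Filter ℕ) ≤ atTop := Ultrafilter.of_le _
  obtain ⟨h, hh⟩ := ultralimit U x 1 (fun n => norm_le_one (hx0 n) (hx1 n))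
  have hhN : h ∈ N := mem_cc.mpr (ultralimit_mem U x (fun i => mem_cc.mp (hxN i)) hh)
  have hh0 : 0 ≤ h := lim_ge hh _ (Eventually.of_forall hx0)
  have hh1 : h ≤ 1 := lim_le hh _ (Eventually.of_forall hx1)
  refine ⟨h, hhN, hh0, hh1, fun c hc hc0 hc1 => ?_⟩
  refine le_trans ?_ (csInf_le hDb ⟨c, hc, hc0, hc1, rfl⟩)
  rw [← hd]
  set A := (τ ((z - h) * (z - h))).re with hA
  have hA0 : 0 ≤ A := (Complex.le_def.mp (hsas h hhN hh0)).1
  have hzh : star (z - h) = z - h := by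
    rw [star_sub, hzs, (IsSelfAdjoint.of_nonneg hh0).star_eq]
  have hlim : Tendsto (fun n => τ ((z - h) * (z - x n))) U (nhds (τ ((z - h) * (z - h)))) := by
    refine tr_lim hM (ultralimit_mul_left U _ ?_ _) fun n =>
      mul_mem (sub_mem hz (hNM hhN)) (sub_mem hz (hNM (hxN n)))
    intro ξ η
    have := (tendsto_const_nhds (x := inner ℂ (z η) ξ)).sub (hh ξ η)
    simpa [inner_sub_left] using this
  have hlim2 : Tendsto (fun n => ‖τ ((z - h) * (z - x n))‖ ^ 2) U (nhds (‖τ ((z - h) * (z - h))‖ ^ 2)) :=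
    hlim.norm.pow 2
  have hlim3 : Tendsto (fun n : ℕ => A * (d + 1 / ((n : ℝ) + 1))) U (nhds (A * (d + 0))) :=
    ((tendsto_const_nhds.add tendsto_one_div_add_atTop_nhds_zero_nat).const_mul A).mono_left hU
  have hle := le_of_tendsto_of_tendsto' hlim2 hlim3 (fun n => by
    have h1 := tr_CS ht (sub_mem hz (hNM hhN)) (sub_mem hz (hNM (hxN n)))
    rw [hzh, ← hA, star_sub, hzs, (IsSelfAdjoint.of_nonneg (hx0 n)).star_eq] at h1
    refine h1.trans ?_
    exact mul_le_mul_of_nonneg_left (hxd n).le hA0)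
  have h2 : A ≤ ‖τ ((z - h) * (z - h))‖ := Complex.re_le_norm _
  rw [add_zero] at hle
  by_contra hcon
  push Not at hcon
  nlinarith

theorem ce_unit {M N : VonNeumannAlgebra H} {τ : Op H →ₗ[ℂ] ℂ} (hM : IsII1Factor M τ)
    (hNM : (N : Set (Op H)) ⊆ (M : Set (Op H)))
    {z : Op H} (hz : z ∈ M) (hz0 : 0 ≤ z) (hz1 : z ≤ 1) :
    ∃ h ∈ N, ∀ y ∈ N, τ (z * y) = τ (h * y) := by
  have ht := hM.trace
  obtain ⟨h, hhN, hh0, hh1, hmin⟩ := ce_min hM hNM hz hz0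
  have hhM : h ∈ M := hNM hhN
  refine ⟨h, hhN, ?_⟩
  have hzs : star z = z := IsSelfAdjoint.of_nonneg hz0
  have hhs : star h = h := IsSelfAdjoint.of_nonneg hh0
  apply sa_ind (N := N) (fun y => τ (z * y) = τ (h * y))
  · intro a b h1 h2; rw [mul_add, mul_add, map_add, map_add, h1, h2]
  · intro c a h1; rw [mul_smul_comm, mul_smul_comm, map_smul, map_smul, h1]
  intro y hy hys
  have hyM : y ∈ M := hNM hy
  have hDM : z - h ∈ M := sub_mem hz hhM
  have hre : (τ ((z - h) * y)).re = 0 := by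
    have hq : ∀ t : ℝ, 0 ≤ t * t * (τ (y * y)).re - 2 * t * (τ ((z - h) * y)).re := by
      intro t
      have htyN : h + t • y ∈ N := add_mem hhN (rsmul_memM t hy)
      obtain ⟨c, hcN, hc0, hc1, hle⟩ := clamp_le ht hNM hz hz0 hz1 htyN (by
        rw [isSelfAdjoint_iff]; simp [hhs, hys.star_eq])
      have h1 := (hmin c hcN hc0 hc1).trans hle
      have h2 : (z - (h + t • y)) * (z - (h + t • y)) = (z - h) * (z - h) - t • ((z - h) * y) -
          t • (y * (z - h)) + (t * t) • (y * y) := by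
        have : z - (h + t • y) = (z - h) - t • y := by abel
        rw [this]
        generalize z - h = D
        simp only [sub_mul, mul_sub, smul_mul_assoc, mul_smul_comm, smul_smul, smul_sub]
        abel
      rw [h2, map_add, map_sub, map_sub, tr_rsmul, tr_rsmul, tr_rsmul, ht.tracial _ hyM _ hDM] at h1
      simp only [Complex.add_re, Complex.sub_re, Complex.re_ofReal_mul] at h1
      linarith
    set B := (τ (y * y)).re
    set T := (τ ((z - h) * y)).re
    have hB0 : 0 ≤ B := by
      have := (Complex.le_def.mp (ht.pos y hyM)).1
      rwa [hys.star_eq] at this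
    have h1 := hq (T / (B + 1))
    have h2 : T / (B + 1) * (T / (B + 1)) * B - 2 * (T / (B + 1)) * T = - (T ^ 2 * (B + 2)) / (B + 1) ^ 2 := by
      field_simp; ring
    rw [h2] at h1
    by_contra hne
    have : 0 < T ^ 2 * (B + 2) / (B + 1) ^ 2 := by positivity
    rw [neg_div] at h1
    linarith
  have him : (τ ((z - h) * y)).im = 0 := by
    have h1 := tr_star ht (mul_mem hDM hyM)
    rw [star_mul, star_sub, hzs, hhs, hys.star_eq, ht.tracial _ hyM _ hDM] at h1
    have := congrArg Complex.im h1
    simp only [Complex.conj_im] at this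
    linarith
  have : τ ((z - h) * y) = 0 := Complex.ext hre him
  rwa [sub_mul, map_sub, sub_eq_zero] at this

theorem ce {M N : VonNeumannAlgebra H} {τ : Op H →ₗ[ℂ] ℂ} (hM : IsII1Factor M τ)
    (hNM : (N : Set (Op H)) ⊆ (M : Set (Op H))) :
    ∀ z ∈ M, ∃ h ∈ N, ∀ y ∈ N, τ (z * y) = τ (h * y) := by
  have hadd : ∀ a b : Op H, (∃ h ∈ N, ∀ y ∈ N, τ (a * y) = τ (h * y)) →
      (∃ h ∈ N, ∀ y ∈ N, τ (b * y) = τ (h * y)) → ∃ h ∈ N, ∀ y ∈ N, τ ((a + b) * y) = τ (h * y) := by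
    rintro a b ⟨h, hh, h1⟩ ⟨h', hh', h2⟩
    exact ⟨h + h', add_mem hh hh', fun y hy => by
      rw [add_mul, add_mul, map_add, map_add, h1 y hy, h2 y hy]⟩
  have hsmul : ∀ (c : ℂ) (a : Op H), (∃ h ∈ N, ∀ y ∈ N, τ (a * y) = τ (h * y)) →
      ∃ h ∈ N, ∀ y ∈ N, τ ((c • a) * y) = τ (h * y) := by
    rintro c a ⟨h, hh, h1⟩
    exact ⟨c • h, smul_memM c hh, fun y hy => by
      rw [smul_mul_assoc, smul_mul_assoc, map_smul, map_smul, h1 y hy]⟩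
  have hpos : ∀ z ∈ M, 0 ≤ z → ∃ h ∈ N, ∀ y ∈ N, τ (z * y) = τ (h * y) := by
    intro z hz hz0
    have hc : 0 < ‖z‖ + 1 := by positivity
    have h1 : (‖z‖ + 1)⁻¹ • z ≤ 1 := by
      have h2 := (IsSelfAdjoint.of_nonneg hz0).le_algebraMap_norm_self
      rw [Algebra.algebraMap_eq_smul_one] at h2
      have h3 : ‖z‖ • (1 : Op H) ≤ (‖z‖ + 1) • (1 : Op H) :=
        SMulPosMono.smul_le_smul_of_nonneg_right zero_le_one (by linarith)
      have := smul_le_smul_of_nonneg_left (h2.trans h3) (inv_nonneg.mpr hc.le)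
      rwa [smul_smul, inv_mul_cancel₀ hc.ne', one_smul] at this
    have h4 := hsmul ((‖z‖ + 1 : ℝ) : ℂ) _ (ce_unit hM hNM (rsmul_memM (‖z‖ + 1)⁻¹ hz)
      (smul_nonneg (inv_nonneg.mpr hc.le) hz0) h1)
    have h5 : ((‖z‖ + 1 : ℝ) : ℂ) • ((‖z‖ + 1)⁻¹ • z) = z := by
      rw [Complex.coe_smul, smul_smul, mul_inv_cancel₀ hc.ne', one_smul]
    rwa [h5] at h4
  refine sa_ind (N := M) (fun z => ∃ h ∈ N, ∀ y ∈ N, τ (z * y) = τ (h * y)) hadd hsmul ?_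
  intro z hz hsa
  rw [← CFC.posPart_sub_negPart z hsa, sub_eq_add_neg]
  refine hadd _ _ (hpos _ (mem_cc.mpr (cent_posPart (mem_cc.mp hz))) (CFC.posPart_nonneg z)) ?_
  have := hsmul (-1) _ (hpos _ (mem_cc.mpr (cent_negPart (mem_cc.mp hz))) (CFC.negPart_nonneg z))
  simpa using this

end part8

section part9

structure Ctx (M N : VonNeumannAlgebra H) (τ : Op H →ₗ[ℂ] ℂ) (p q v : Op H) (φ : Op H → Op H) :
    Prop where
  hM : IsII1Factor M τ
  hN : IsII1Factor N τ
  hNM : (N : Set (Op H)) ⊆ (M : Set (Op H))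
  hirr : relComm (N : Set (Op H)) (M : Set (Op H)) = scalars H
  hp : p ∈ M
  hpp : IsProjection p
  hpne : p ≠ 0
  hq : q ∈ N
  hqp : IsProjection q
  hφ : IsStarHomOn φ (corner p (M : Set (Op H))) (corner q (N : Set (Op H)))
  hφ1 : φ p = q
  hv : v ∈ M
  hvne : v ≠ 0
  hvqp : q * v * p = v
  hint : ∀ x ∈ corner p (M : Set (Op H)), φ x * v = v * x

theorem corner_left {e x : Op H} (he : IsProjection e) (hx : e * x * e = x) : e * x = x := by
  rw [← hx, ← mul_assoc, ← mul_assoc, he.2.eq]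

theorem corner_right {e x : Op H} (he : IsProjection e) (hx : e * x * e = x) : x * e = x := by
  rw [← hx, mul_assoc, he.2.eq]

theorem proj_nonneg {e : Op H} (he : IsProjection e) : 0 ≤ e := by
  have := star_mul_self_nonneg e
  rwa [he.1.star_eq, he.2.eq] at this

theorem proj_le_one {e : Op H} (he : IsProjection e) : e ≤ 1 := by
  have h : IsProjection (1 - e) := by
    refine ⟨?_, ?_⟩
    · rw [isSelfAdjoint_iff]; simp [he.1.star_eq]
    · change (1 - e) * (1 - e) = 1 - e
      rw [mul_sub, sub_mul, sub_mul, he.2.eq]; simp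
  exact sub_nonneg.mp (proj_nonneg h)

theorem proj_sub {e f : Op H} (he : IsProjection e) (hf : IsProjection f) (h : e * f = e) :
    IsProjection (f - e) := by
  have h' : f * e = e := by
    have := congrArg star h
    rwa [star_mul, he.1.star_eq, hf.1.star_eq] at this
  refine ⟨hf.1.sub he.1, ?_⟩
  change (f - e) * (f - e) = f - e
  rw [mul_sub, sub_mul, sub_mul, he.2.eq, hf.2.eq, h, h']; simp

theorem corner_center {M : VonNeumannAlgebra H} {τ : Op H →ₗ[ℂ] ℂ} (hM : IsII1Factor M τ) {p : Op H}
    (hp : p ∈ M) (hpp : IsProjection p) {x : Op H} (hx : x ∈ M) (hxp : p * x * p = x)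
    (hc : ∀ y ∈ corner p (M : Set (Op H)), y * x = x * y) : ∃ c : ℂ, x = c • p := by
  have hps : star p = p := hpp.1
  let S : Set (Op H) := Set.centralizer (M : Set (Op H)) ∪ corner p (M : Set (Op H))
  have hS : SC S := by
    rintro y (hy | hy)
    · exact Or.inl (SC_comm M y hy)
    · refine Or.inr ⟨star_mem (S := VonNeumannAlgebra H) hy.1, ?_⟩
      have := congrArg star hy.2
      simpa [hps, mul_assoc] using this
  have hpC : p ∈ corner p (M : Set (Op H)) := ⟨hp, by rw [hpp.2.eq, hpp.2.eq]⟩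
  have hin : ∀ y, y ∈ M → (∀ z ∈ corner p (M : Set (Op H)), z * y = y * z) → y ∈ Set.centralizer S := by
    rintro y hy h z (hz | hz)
    · exact mem_cc.mp hy z hz
    · exact h z hz
  have hout : ∀ y ∈ Set.centralizer S, y ∈ M := fun y hy => mem_cc.mpr fun z hz => hy z (Or.inl hz)
  refine scalar_lemma hS (hin p hp fun z hz => ?_) hpp ?_ (hin x hx hc) hxp
  · rw [corner_left hpp hz.2, corner_right hpp hz.2]
  · intro a ha b hb _ _ hap hbp hab
    apply irr_zero M M le_rfl hM.factor (hout b hb)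
    intro m hm
    have h1 : p * b = b := by rw [hb p (Or.inr hpC), hbp]
    have h2 : p * m * p ∈ corner p (M : Set (Op H)) := by
      refine ⟨mul_mem (mul_mem hp hm) hp, ?_⟩
      simp only [mul_assoc, hpp.2.eq]
      rw [← mul_assoc p p, hpp.2.eq]
    calc a * m * b = a * (p * m * p) * b := by
          nth_rw 1 [← hap, ← h1]; simp only [mul_assoc]
      _ = p * m * p * (a * b) := by rw [← ha _ (Or.inr h2), mul_assoc]
      _ = 0 := by rw [hab, mul_zero]

variable {M N : VonNeumannAlgebra H} {τ : Op H →ₗ[ℂ] ℂ} {p q v : Op H} {φ : Op H → Op H}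

theorem corner_star (hpp : IsProjection p) {x : Op H} (hx : x ∈ corner p (M : Set (Op H))) :
    star x ∈ corner p (M : Set (Op H)) := by
  refine ⟨star_mem (S := VonNeumannAlgebra H) hx.1, ?_⟩
  have := congrArg star hx.2
  simpa [hpp.1.star_eq, mul_assoc] using this

theorem Ctx.qv (c : Ctx M N τ p q v φ) : q * v = v := by
  rw [← c.hvqp, ← mul_assoc, ← mul_assoc, c.hqp.2.eq]

theorem Ctx.vp (c : Ctx M N τ p q v φ) : v * p = v := by
  rw [← c.hvqp, mul_assoc, c.hpp.2.eq]

theorem Ctx.pC (c : Ctx M N τ p q v φ) : p ∈ corner p (M : Set (Op H)) :=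
  ⟨c.hp, by rw [c.hpp.2.eq, c.hpp.2.eq]⟩

theorem Ctx.cut (c : Ctx M N τ p q v φ) {f : Op H} (hf : f ∈ N) (hfp : IsProjection f)
    (hc : ∀ x ∈ corner p (M : Set (Op H)), φ x * f = f * φ x) (hfv : f * v ≠ 0) :
    ∃ s : ℝ, s ≠ 0 ∧ star (s • (f * v)) * (s • (f * v)) = p := by
  have hfM : f ∈ M := c.hNM hf
  have hfs : star f = f := hfp.1
  have hvs : p * star v = star v := by
    have := congrArg star c.vp
    rwa [star_mul, c.hpp.1.star_eq] at this
  have h0 : star (f * v) * (f * v) = star v * f * v := by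
    rw [star_mul, hfs, mul_assoc, ← mul_assoc f, hfp.2.eq, mul_assoc]
  obtain ⟨k, hk⟩ := corner_center c.hM c.hp c.hpp (x := star v * f * v)
    (mul_mem (mul_mem (star_mem c.hv) hfM) c.hv)
    (by rw [← mul_assoc, ← mul_assoc, hvs, mul_assoc, c.vp]) (by
      intro x hx
      have h1 := c.hint _ (corner_star c.hpp hx)
      rw [c.hφ.2.2.2.2 x hx] at h1
      have h2 := congrArg star h1
      rw [star_mul, star_mul, star_star, star_star] at h2
      rw [← mul_assoc, ← mul_assoc, ← h2, mul_assoc _ (φ x), hc x hx, mul_assoc _ v, ← c.hint x hx]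
      simp only [mul_assoc])
  have hne : star (f * v) * (f * v) ≠ 0 := fun h => hfv (star_mul_self_zero h)
  have hpos := tr_pos c.hM.trace (mul_mem (star_mem (mul_mem hfM c.hv)) (mul_mem hfM c.hv))
    (star_mul_self_nonneg (f * v)) hne
  have hppos := tr_pos c.hM.trace c.hp (proj_nonneg c.hpp) c.hpne
  rw [← h0] at hk
  obtain ⟨h1, h2⟩ := hpos
  obtain ⟨h3, h4⟩ := hppos
  set a := (τ (star (f * v) * (f * v))).re
  set b := (τ p).re
  have hka : k = ((a / b : ℝ) : ℂ) := by
    have := congrArg τ hk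
    rw [h2, map_smul, smul_eq_mul, h4] at this
    have hb : (b : ℂ) ≠ 0 := by exact_mod_cast h3.ne'
    push_cast
    rw [eq_div_iff hb, this]
  have hab : 0 < a / b := by positivity
  refine ⟨(√(a / b))⁻¹, by positivity, ?_⟩
  rw [star_smul, smul_mul_assoc, mul_smul_comm, smul_smul, hk, hka, star_trivial, Complex.coe_smul,
    smul_smul, ← mul_inv, Real.mul_self_sqrt hab.le, inv_mul_cancel₀ hab.ne', one_smul]

theorem Ctx.tr_cut (c : Ctx M N τ p q v φ) {f : Op H} (hf : f ∈ N) (hfp : IsProjection f)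
    (hc : ∀ x ∈ corner p (M : Set (Op H)), φ x * f = f * φ x) (hfv : f * v ≠ 0) :
    (τ p).re ≤ (τ f).re := by
  obtain ⟨s, hs, hw⟩ := c.cut hf hfp hc hfv
  have hfM : f ∈ M := c.hNM hf
  set w := s • (f * v) with hwd
  have hwM : w ∈ M := rsmul_memM _ (mul_mem hfM c.hv)
  have hfw : f * w = w := by rw [hwd, mul_smul_comm, ← mul_assoc, hfp.2.eq]
  have hwp : w * p = w := by rw [hwd, smul_mul_assoc, mul_assoc, c.vp]
  have hww : IsProjection (w * star w) := by
    refine ⟨by rw [isSelfAdjoint_iff]; simp, ?_⟩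
    change (w * star w) * (w * star w) = w * star w
    rw [mul_assoc, ← mul_assoc (star w), hw, ← mul_assoc, hwp]
  have h1 : (w * star w) * f = w * star w := by
    have := congrArg star hfw
    rw [star_mul, hfp.1.star_eq] at this
    rw [mul_assoc, this]
  have h2 := tr_nonneg c.hM.trace (sub_mem hfM (mul_mem hwM (star_mem hwM)))
    (proj_nonneg (proj_sub hww hfp h1))
  rw [map_sub, c.hM.trace.tracial _ hwM _ (star_mem hwM), hw] at h2
  have := (Complex.le_def.mp h2).1
  simpa using this

theorem Ctx.minimal (c : Ctx M N τ p q v φ) {S : Set (Op H)} (hS : SC S) 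
    (hSv : ∀ f ∈ Set.centralizer S, f ∈ N) {f : Op H} (hf : f ∈ Set.centralizer S) (hfp : IsProjection f) :
    ∃ r ∈ Set.centralizer S, IsProjection r ∧ r * f = r ∧ r * v = f * v ∧
      ∀ a ∈ Set.centralizer S, a * r = a → a * v = 0 → a = 0 := by
  let T := Set.centralizer (Set.centralizer S)
  let K0 : Submodule ℂ H := Submodule.span ℂ {ζ | ∃ s ∈ T, ∃ ξ : H, ζ = s (f (v ξ))}
  let K : Submodule ℂ H := K0.topologicalClosure
  have : CompleteSpace K := (Submodule.isClosed_topologicalClosure K0).completeSpace_coe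
  have hext : ∀ A B : Op H, (∀ s ∈ T, ∀ ξ, A (s (f (v ξ))) = B (s (f (v ξ)))) → ∀ ζ ∈ K, A ζ = B ζ := by
    intro A B hAB ζ hζ
    have hcl : IsClosed {ζ : H | A ζ = B ζ} := isClosed_eq A.continuous B.continuous
    have hsub : (K0 : Set H) ⊆ {ζ : H | A ζ = B ζ} := by
      intro ζ hζ
      refine Submodule.span_induction (p := fun ζ _ => A ζ = B ζ) ?_ ?_ ?_ ?_ hζ
      · rintro _ ⟨s, hs, ξ, rfl⟩; exact hAB s hs ξ
      · simp
      · intro x y _ _ h1 h2; rw [map_add, map_add, h1, h2]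
      · intro a x _ h1; rw [map_smul, map_smul, h1]
    exact closure_minimal hsub hcl hζ
  have hinv : ∀ s ∈ S, ∀ ζ ∈ K, s ζ ∈ K := by
    intro s hs ζ hζ
    have hsT : s ∈ T := fun a ha => (ha s hs).symm
    have hcl : IsClosed {ζ : H | s ζ ∈ K} :=
      (Submodule.isClosed_topologicalClosure K0).preimage s.continuous
    have hsub : (K0 : Set H) ⊆ {ζ : H | s ζ ∈ K} := by
      intro ζ hζ
      refine Submodule.span_induction (p := fun ζ _ => s ζ ∈ K) ?_ ?_ ?_ ?_ hζ
      · rintro _ ⟨t, ht, ξ, rfl⟩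
        apply Submodule.le_topologicalClosure
        apply Submodule.subset_span
        exact ⟨s * t, Set.mul_mem_centralizer hsT ht, ξ, rfl⟩
      · rw [map_zero]; exact zero_mem K
      · intro x y _ _ h1 h2; rw [map_add]; exact add_mem h1 h2
      · intro a x _ h1; rw [map_smul]; exact Submodule.smul_mem _ _ h1
    exact closure_minimal hsub hcl hζ
  set r : Op H := K.starProjection with hr
  have hrS : r ∈ Set.centralizer S := proj_mem hS K hinv
  have hrp : IsProjection r :=
    ⟨isSelfAdjoint_starProjection K, K.isIdempotentElem_starProjection⟩
  have hrmem : ∀ ζ, r ζ ∈ K := fun ζ => Submodule.starProjection_apply_mem K ζ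
  have hfr : f * r = r := by
    ext ζ
    rw [opmul]
    refine hext f 1 ?_ (r ζ) (hrmem ζ)
    intro s hs ξ
    have h1 : f * s * f = s * f := by rw [hs f hf, mul_assoc, hfp.2.eq]
    have := congrArg (fun A : Op H => A (v ξ)) h1
    simpa [opmul] using this
  have hrf : r * f = r := by
    have := congrArg star hfr
    rwa [star_mul, hfp.1.star_eq, hrp.1.star_eq] at this
  have hrv : r * v = f * v := by
    rw [← hrf, mul_assoc]
    ext ξ
    rw [opmul]
    apply Submodule.starProjection_eq_self_iff.mpr
    apply Submodule.le_topologicalClosure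
    apply Submodule.subset_span
    exact ⟨1, Set.one_mem_centralizer, ξ, rfl⟩
  refine ⟨r, hrS, hrp, hrf, hrv, ?_⟩
  intro a ha har hav
  have haf : a * f = a := by rw [← har, mul_assoc, hrf]
  rw [← har]
  ext ζ
  rw [opmul]
  refine hext a 0 ?_ _ (hrmem ζ)
  intro s hs ξ
  have h1 : a * s * f * v = 0 := by rw [hs a ha, mul_assoc s, haf, mul_assoc, hav, mul_zero]
  have := congrArg (fun A : Op H => A ξ) h1
  simpa [opmul] using this

theorem Ctx.choose_r (c : Ctx M N τ p q v φ) : ∃ r ∈ N, IsProjection r ∧ r * q = r ∧ r * v ≠ 0 ∧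
    (∀ x ∈ corner p (M : Set (Op H)), φ x * r = r * φ x) ∧
    (∀ y ∈ N, r * y * r = y → (∀ x ∈ corner p (M : Set (Op H)), φ x * y = y * φ x) →
      ∃ k : ℂ, y = k • r) := by
  have ht := c.hM.trace
  let S : Set (Op H) := Set.centralizer (N : Set (Op H)) ∪ {y | ∃ x ∈ corner p (M : Set (Op H)), y = φ x}
  have hS : SC S := by
    rintro y (hy | ⟨x, hx, rfl⟩)
    · exact Or.inl (SC_comm N y hy)
    · exact Or.inr ⟨star x, corner_star c.hpp hx, (c.hφ.2.2.2.2 x hx).symm⟩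
  have hin : ∀ y, y ∈ N → (∀ x ∈ corner p (M : Set (Op H)), φ x * y = y * φ x) → y ∈ Set.centralizer S := by
    rintro y hy h z (hz | ⟨x, hx, rfl⟩)
    · exact mem_cc.mp hy z hz
    · exact h x hx
  have hout : ∀ y ∈ Set.centralizer S, y ∈ N := fun y hy => mem_cc.mpr fun z hz => hy z (Or.inl hz)
  have hcomm : ∀ y ∈ Set.centralizer S, ∀ x ∈ corner p (M : Set (Op H)), φ x * y = y * φ x :=
    fun y hy x hx => hy _ (Or.inr ⟨x, hx, rfl⟩)
  have hqS : q ∈ Set.centralizer S := hin q c.hq fun x hx => by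
    have := (c.hφ.1 x hx).2
    rw [corner_left c.hqp this, corner_right c.hqp this]
  let D : Set ℝ := {d | ∃ f ∈ Set.centralizer S, IsProjection f ∧ f * q = f ∧ f * v ≠ 0 ∧ d = (τ f).re}
  have hDb : BddBelow D := ⟨0, by
    rintro d ⟨f, hf, hfp, _, _, rfl⟩
    exact (Complex.le_def.mp (tr_nonneg ht (c.hNM (hout f hf)) (proj_nonneg hfp))).1⟩
  have hDne : D.Nonempty := ⟨_, q, hqS, c.hqp, c.hqp.2, by rw [c.qv]; exact c.hvne, rfl⟩
  have hpp := (tr_pos ht c.hp (proj_nonneg c.hpp) c.hpne).1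
  obtain ⟨_, ⟨f, hf, hfp, hfq, hfv, rfl⟩, hlt⟩ := exists_lt_of_csInf_lt hDne
    (show sInf D < sInf D + (τ p).re by linarith)
  obtain ⟨r, hrS, hrp, hrf, hrv, hra⟩ := c.minimal hS hout hf hfp
  have hrq : r * q = r := by rw [← hrf, mul_assoc, hfq]
  have hrs : star r = r := hrp.1
  refine ⟨r, hout r hrS, hrp, hrq, by rw [hrv]; exact hfv, hcomm r hrS, ?_⟩
  intro y hy hyr hyc
  refine scalar_lemma hS hrS hrp ?_ (hin y hy hyc) hyr
  intro a ha b hb ha0 hb0 har hbr hab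
  by_contra hcon
  push Not at hcon
  obtain ⟨hane, hbne⟩ := hcon
  obtain ⟨g, hgS, hgp, hag, hgb⟩ := supp_exists hS ha
  have hgr : g * r = g := by
    have := hgb (1 - r) (by rw [mul_sub, har]; simp)
    rw [mul_sub, mul_one, sub_eq_zero] at this
    exact this.symm
  have hgbz := hgb b hab
  have hgne : g ≠ 0 := by
    intro h; apply hane; rw [← hag, h, mul_zero]
  have hgv : g * v ≠ 0 := fun h => hgne (hra g hgS hgr h)
  have hdS : r - g ∈ Set.centralizer S := fun z hz => by rw [mul_sub, sub_mul, hrS z hz, hgS z hz]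
  have hdp := proj_sub hgp hrp hgr
  have hrb : r * b = b := by
    have := congrArg star hbr
    rwa [star_mul, hrs, (IsSelfAdjoint.of_nonneg hb0).star_eq] at this
  have hdv : (r - g) * v ≠ 0 := by
    intro h
    have := hra _ hdS (by rw [sub_mul, hrp.2.eq, hgr]) h
    apply hbne
    rw [← hrb, sub_eq_zero.mp this, hgbz]
  have e1 : sInf D ≤ (τ g).re := csInf_le hDb ⟨g, hgS, hgp, by rw [← hgr, mul_assoc, hrq], hgv, rfl⟩
  have e2 := c.tr_cut (hout _ hdS) hdp (hcomm _ hdS) hdv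
  have e3 := tr_nonneg ht (sub_mem (c.hNM (hout f hf)) (c.hNM (hout r hrS))) (proj_nonneg (proj_sub hrp hfp hrf))
  have e4 := (Complex.le_def.mp e3).1
  rw [map_sub] at e2 e4
  simp only [Complex.zero_re, Complex.sub_re] at e2 e4
  linarith

end part9

section part10

structure Wt (M N : VonNeumannAlgebra H) (τ : Op H →ₗ[ℂ] ℂ) (p r w : Op H) (ψ : Op H → Op H) :
    Prop where
  hM : IsII1Factor M τ
  hNM : (N : Set (Op H)) ⊆ (M : Set (Op H))
  hirr : relComm (N : Set (Op H)) (M : Set (Op H)) = scalars H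
  hp : p ∈ M
  hpp : IsProjection p
  hpne : p ≠ 0
  hr : r ∈ N
  hrp : IsProjection r
  hψ : IsStarHomOn ψ (corner p (M : Set (Op H))) (corner r (N : Set (Op H)))
  hψ1 : ψ p = r
  hw : w ∈ M
  hww : star w * w = p
  hwp : w * p = w
  hrw : r * w = w
  hint : ∀ x ∈ corner p (M : Set (Op H)), ψ x * w = w * x
  hB : ∀ y ∈ N, r * y * r = y → (∀ x ∈ corner p (M : Set (Op H)), ψ x * y = y * ψ x) →
      ∃ k : ℂ, y = k • r

section wt
variable {M N : VonNeumannAlgebra H} {τ : Op H →ₗ[ℂ] ℂ} {p r w : Op H} {ψ : Op H → Op H}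

theorem tr_uniq {M : VonNeumannAlgebra H} (ht : IsTracialState (M : Set (Op H)) τ)
    {S : Set (Op H)} {a b : Op H} (ha : a ∈ M) (hb : b ∈ M) (hS : star (a - b) ∈ S)
    (h : ∀ y ∈ S, τ (a * y) = τ (b * y)) : a = b := by
  have h1 := h _ hS
  rw [← sub_eq_zero, ← map_sub, ← sub_mul] at h1
  rw [ht.tracial _ (sub_mem ha hb) _ (star_mem (S := VonNeumannAlgebra H) (sub_mem ha hb))] at h1
  exact sub_eq_zero.mp (ht.faithful _ (sub_mem ha hb) h1)

theorem Wt.wne (c : Wt M N τ p r w ψ) : w ≠ 0 := by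
  intro h; apply c.hpne; rw [← c.hww, h, mul_zero]

theorem Wt.pws (c : Wt M N τ p r w ψ) : p * star w = star w := by
  have := congrArg star c.hwp
  rwa [star_mul, c.hpp.1.star_eq] at this

theorem Wt.wsr (c : Wt M N τ p r w ψ) : star w * r = star w := by
  have := congrArg star c.hrw
  rwa [star_mul, c.hrp.1.star_eq] at this

theorem Wt.ep (c : Wt M N τ p r w ψ) : IsProjection (w * star w) := by
  refine ⟨by rw [isSelfAdjoint_iff]; simp, ?_⟩
  change (w * star w) * (w * star w) = w * star w
  rw [mul_assoc, ← mul_assoc (star w), c.hww, ← mul_assoc, c.hwp]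

theorem Wt.eM (c : Wt M N τ p r w ψ) : w * star w ∈ M := mul_mem c.hw (star_mem c.hw)

theorem Wt.ene (c : Wt M N τ p r w ψ) : w * star w ≠ 0 := by
  intro h
  have : star (star w) * star w = 0 := by rw [star_star, h]
  have h2 := star_mul_self_zero this
  exact c.wne (by rw [← star_star w, h2, star_zero])

theorem Wt.er (c : Wt M N τ p r w ψ) : (w * star w) * r = w * star w := by
  rw [mul_assoc, c.wsr]

theorem Wt.re (c : Wt M N τ p r w ψ) : r * (w * star w) = w * star w := by
  rw [← mul_assoc, c.hrw]

theorem Wt.rne (c : Wt M N τ p r w ψ) : r ≠ 0 := by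
  intro h; apply c.wne; rw [← c.hrw, h, zero_mul]

theorem Wt.Cmem (c : Wt M N τ p r w ψ) {m : Op H} (hm : m ∈ M) :
    star w * m * w ∈ corner p (M : Set (Op H)) := by
  refine ⟨mul_mem (mul_mem (star_mem c.hw) hm) c.hw, ?_⟩
  rw [← mul_assoc, ← mul_assoc, c.pws, mul_assoc, c.hwp]

theorem Wt.eme (c : Wt M N τ p r w ψ) {m : Op H} (hm : m ∈ M) :
    (w * star w) * m * (w * star w) = ψ (star w * m * w) * (w * star w) := by
  rw [← mul_assoc (ψ _), c.hint _ (c.Cmem hm)]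
  simp only [mul_assoc]

theorem Wt.eB (c : Wt M N τ p r w ψ) {x : Op H} (hx : x ∈ corner p (M : Set (Op H))) :
    (w * star w) * ψ x = ψ x * (w * star w) := by
  have h1 := c.hint _ (corner_star c.hpp hx)
  rw [c.hψ.2.2.2.2 x hx] at h1
  have h2 := congrArg star h1
  rw [star_mul, star_mul, star_star, star_star] at h2
  rw [mul_assoc, h2, ← mul_assoc (ψ x), c.hint x hx, mul_assoc]

theorem Wt.ψN (c : Wt M N τ p r w ψ) {x : Op H} (hx : x ∈ corner p (M : Set (Op H))) : ψ x ∈ N :=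
  (c.hψ.1 x hx).1

theorem Wt.rψ (c : Wt M N τ p r w ψ) {x : Op H} (hx : x ∈ corner p (M : Set (Op H))) :
    r * ψ x = ψ x := corner_left c.hrp (c.hψ.1 x hx).2

theorem Wt.ψr (c : Wt M N τ p r w ψ) {x : Op H} (hx : x ∈ corner p (M : Set (Op H))) :
    ψ x * r = ψ x := corner_right c.hrp (c.hψ.1 x hx).2

theorem Wt.ψsub (c : Wt M N τ p r w ψ) {x y : Op H} (hx : x ∈ corner p (M : Set (Op H)))
    (hy : y ∈ corner p (M : Set (Op H))) :
    x - y ∈ corner p (M : Set (Op H)) ∧ ψ (x - y) = ψ x - ψ y := by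
  have h : x - y ∈ corner p (M : Set (Op H)) :=
    ⟨sub_mem (S := VonNeumannAlgebra H) hx.1 hy.1, by rw [mul_sub, sub_mul, hx.2, hy.2]⟩
  refine ⟨h, ?_⟩
  have := c.hψ.2.1 _ h _ hy
  rw [sub_add_cancel] at this
  rw [this, add_sub_cancel_right]

theorem Wt.uniqB (c : Wt M N τ p r w ψ) {x y : Op H} (hx : x ∈ corner p (M : Set (Op H)))
    (hy : y ∈ corner p (M : Set (Op H)))
    (h : ∀ z ∈ corner p (M : Set (Op H)), τ (ψ x * ψ z) = τ (ψ y * ψ z)) : ψ x = ψ y := by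
  refine tr_uniq c.hM.trace (S := {b | ∃ z ∈ corner p (M : Set (Op H)), b = ψ z})
    (c.hNM (c.ψN hx)) (c.hNM (c.ψN hy)) ?_ ?_
  · obtain ⟨h1, h2⟩ := c.ψsub hx hy
    exact ⟨star (x - y), corner_star c.hpp h1, by rw [c.hψ.2.2.2.2 _ h1, h2]⟩
  · rintro _ ⟨z, hz, rfl⟩; exact h z hz

theorem Wt.tr_e (c : Wt M N τ p r w ψ) :
    ∃ l : ℝ, 0 < l ∧ ∀ y ∈ N, τ ((w * star w) * y) = l * τ (r * y) := by
  have ht := c.hM.trace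
  have cy : ∀ a ∈ M, ∀ b ∈ M, τ (a * b) = τ (b * a) := ht.tracial
  obtain ⟨h, hh, hy⟩ := ce c.hM c.hNM _ c.eM
  have hrM := c.hNM c.hr
  have hhM := c.hNM hh
  have hk : ∀ y ∈ N, τ (r * h * r * y) = τ ((w * star w) * y) := by
    intro y hyN
    have hyM := c.hNM hyN
    calc τ (r * h * r * y) = τ (r * (h * (r * y))) := by simp only [mul_assoc]
      _ = τ (h * (r * y) * r) := cy _ hrM _ (mul_mem hhM (mul_mem hrM hyM))
      _ = τ (h * (r * y * r)) := by simp only [mul_assoc]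
      _ = τ ((w * star w) * (r * y * r)) := (hy _ (mul_mem (mul_mem c.hr hyN) c.hr)).symm
      _ = τ ((w * star w) * y * r) := by rw [← mul_assoc, ← mul_assoc, c.er]
      _ = τ (r * ((w * star w) * y)) := cy _ (mul_mem c.eM hyM) _ hrM
      _ = _ := by rw [← mul_assoc, c.re]
  have hkN : r * h * r ∈ N := mul_mem (mul_mem c.hr hh) c.hr
  obtain ⟨k, hkr⟩ := c.hB _ hkN (by
    simp only [mul_assoc, c.hrp.2.eq]
    rw [← mul_assoc r r, c.hrp.2.eq]) (by
    intro x hx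
    have hxN := c.ψN hx
    have hxM := c.hNM hxN
    have hkM := c.hNM hkN
    refine tr_uniq (M := M) ht (S := N) (mul_mem hxM hkM) (mul_mem hkM hxM)
      (star_mem (S := VonNeumannAlgebra H) (sub_mem (mul_mem hxN hkN) (mul_mem hkN hxN))) ?_
    intro y hyN
    have hyM := c.hNM hyN
    rw [mul_assoc, cy _ hxM _ (mul_mem hkM hyM), mul_assoc, hk _ (mul_mem hyN hxN), mul_assoc _ (ψ x),
      hk _ (mul_mem hxN hyN), ← mul_assoc, cy _ (mul_mem c.eM hyM) _ hxM, ← mul_assoc (w * star w), c.eB hx]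
    simp only [mul_assoc])
  have hp1 := tr_pos ht c.hp (proj_nonneg c.hpp) c.hpne
  have hp2 := tr_pos ht hrM (proj_nonneg c.hrp) c.rne
  have hkv : k = (((τ p).re / (τ r).re : ℝ) : ℂ) := by
    have := hk 1 (one_mem _)
    rw [mul_one, mul_one, hkr, map_smul, smul_eq_mul, cy _ c.hw _ (star_mem c.hw), c.hww, hp1.2, hp2.2] at this
    push_cast
    rw [eq_div_iff (by exact_mod_cast hp2.1.ne'), this]
  refine ⟨_, div_pos hp1.1 hp2.1, ?_⟩
  intro y hyN
  rw [← hk y hyN, hkr, smul_mul_assoc, map_smul, smul_eq_mul, hkv]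

theorem Wt.trF (c : Wt M N τ p r w ψ) {y x : Op H} (hy : y ∈ N) (hx : x ∈ corner p (M : Set (Op H))) :
    τ (ψ (star w * y * w) * ψ x) = τ (r * y * ψ x) := by
  obtain ⟨l, hl, h⟩ := c.tr_e
  have cy : ∀ a ∈ M, ∀ b ∈ M, τ (a * b) = τ (b * a) := c.hM.trace.tracial
  have hyM := c.hNM hy
  have hz := c.Cmem hyM
  have hxM := c.hNM (c.ψN hx)
  have hl' : (l : ℂ) ≠ 0 := by exact_mod_cast hl.ne'
  apply mul_left_cancel₀ hl'
  rw [mul_assoc r, ← h _ (mul_mem hy (c.ψN hx)), ← c.rψ hz, mul_assoc r,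
    ← h _ (mul_mem (c.ψN hz) (c.ψN hx)), ← mul_assoc, c.eB hz, ← c.eme hyM]
  rw [mul_assoc _ _ (ψ x), c.eB hx, ← mul_assoc,
    cy _ (mul_mem (mul_mem c.eM hyM) hxM) _ c.eM, ← mul_assoc, ← mul_assoc, c.ep.2.eq, mul_assoc]

theorem Wt.pull (c : Wt M N τ p r w ψ) {m : Op H} (hm : m ∈ M) :
    ∃ n ∈ N, n * r = n ∧ m * (w * star w) = n * (w * star w) := by
  obtain ⟨l, hl, h⟩ := c.tr_e
  have cy : ∀ a ∈ M, ∀ b ∈ M, τ (a * b) = τ (b * a) := c.hM.trace.tracial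
  obtain ⟨n0, hn0, hn⟩ := ce c.hM c.hNM _ (mul_mem hm c.eM)
  have hl' : (l : ℂ) ≠ 0 := by exact_mod_cast hl.ne'
  have hnN : l⁻¹ • (n0 * r) ∈ N := rsmul_memM _ (mul_mem hn0 c.hr)
  set n := l⁻¹ • (n0 * r) with hnd
  have hnr : n * r = n := by rw [hnd, smul_mul_assoc, mul_assoc, c.hrp.2.eq]
  have htn : ∀ y ∈ N, τ (m * (w * star w) * y) = l * τ (n * y) := by
    intro y hy
    rw [hnd, smul_mul_assoc, tr_rsmul, mul_assoc n0, ← hn _ (mul_mem c.hr hy), mul_assoc m, mul_assoc m,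
      ← mul_assoc (w * star w) r, c.er]
    push_cast
    rw [mul_inv_cancel_left₀ hl']
  refine ⟨n, hnN, hnr, ?_⟩
  have hnM := c.hNM hnN
  set e := w * star w with he
  have heM : e ∈ M := c.eM
  have hd : m * e - n * e ∈ M := sub_mem (mul_mem hm heM) (mul_mem hnM heM)
  have key := irr_zero M N c.hNM c.hirr (a := e) hd (by
    intro y hy
    have hyM := c.hNM hy
    have h1 : e * y * (m * e) = ψ (star w * (y * m) * w) * e := by
      rw [← c.eme (mul_mem hyM hm)]; simp only [he, mul_assoc]
    have h2 : e * y * (n * e) = ψ (star w * (y * n) * w) * e := by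
      rw [← c.eme (mul_mem hyM hnM)]; simp only [he, mul_assoc]
    rw [mul_sub, h1, h2, sub_eq_zero]
    congr 1
    have hz1 := c.Cmem (mul_mem hyM hm)
    have hz2 := c.Cmem (mul_mem hyM hnM)
    refine c.uniqB hz1 hz2 ?_
    intro x hx
    have hxN := c.ψN hx
    have hxM := c.hNM hxN
    rw [c.trF (mul_mem hy hnN) hx]
    apply mul_left_cancel₀ hl'
    have hL : l * τ (ψ (star w * (y * m) * w) * ψ x) = τ (e * (y * m) * e * ψ x) := by
      rw [← c.rψ hz1, mul_assoc r, ← h _ (mul_mem (c.ψN hz1) hxN), ← mul_assoc, c.eB hz1,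
        ← c.eme (mul_mem hyM hm)]
    have hcc : e * ψ x = ψ x * e := c.eB hx
    have hee : e * e = e := c.ep.2.eq
    rw [hL]
    calc τ (e * (y * m) * e * ψ x) = τ ((e * y) * (m * e * ψ x)) := by simp only [mul_assoc]
      _ = τ ((m * e * ψ x) * (e * y)) := cy _ (mul_mem heM hyM) _ (mul_mem (mul_mem hm heM) hxM)
      _ = τ (m * (e * ψ x) * e * y) := by simp only [mul_assoc]
      _ = τ (m * e * (ψ x * y)) := by
          rw [mul_assoc m, mul_assoc e, ← hcc, ← mul_assoc e, hee]; simp only [mul_assoc]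
      _ = l * τ (n * (ψ x * y)) := htn _ (mul_mem hxN hy)
      _ = l * τ (n * r * (ψ x * y)) := by rw [hnr]
      _ = l * τ (n * (ψ x * y)) := by rw [hnr]
      _ = l * τ (r * (y * n) * ψ x) := by
          congr 1
          rw [cy _ (mul_mem (mul_mem (c.hNM c.hr) (mul_mem hyM hnM)) hxM |> fun _ => hnM) _ (mul_mem hxM hyM),
            mul_assoc (ψ x), cy _ hxM _ (mul_mem hyM hnM), ← c.ψr hx, ← mul_assoc,
            cy _ (mul_mem (mul_mem hyM hnM) hxM) _ (c.hNM c.hr), c.ψr hx, ← mul_assoc])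
  rcases key with h0 | h0
  · exact absurd h0 c.ene
  · exact sub_eq_zero.mp h0

theorem Wt.pull' (c : Wt M N τ p r w ψ) {m : Op H} (hm : m ∈ M) (hrm : r * m = m) :
    ∃ n ∈ corner r (N : Set (Op H)), m * (w * star w) = n * (w * star w) := by
  obtain ⟨n, hn, hnr, h⟩ := c.pull hm
  refine ⟨r * n, ⟨mul_mem c.hr hn, ?_⟩, ?_⟩
  · rw [← mul_assoc, c.hrp.2.eq, mul_assoc, hnr]
  · rw [mul_assoc, ← h, ← mul_assoc r, hrm]

theorem Wt.basis (c : Wt M N τ p r w ψ) : ∃ (ι : Type) (_ : Fintype ι) (n : ι → Op H),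
    (∀ i, n i ∈ corner r (N : Set (Op H))) ∧ ∑ i, n i * (w * star w) * star (n i) = r := by
  obtain ⟨ι, _, m, hm, hs⟩ := simple c.hM c.eM (proj_nonneg c.ep) c.ene
  have hrM := c.hNM c.hr
  choose n hn hne using fun i => c.pull' (mul_mem hrM (hm i)) (by rw [← mul_assoc, c.hrp.2.eq])
  refine ⟨ι, inferInstance, n, hn, ?_⟩
  have h1 : ∀ a : Op H, a * (w * star w) * star a = (a * (w * star w)) * star (a * (w * star w)) := by
    intro a
    rw [star_mul, c.ep.1.star_eq, ← mul_assoc (a * (w * star w)), mul_assoc a (w * star w) (w * star w), c.ep.2.eq]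
  calc ∑ i, n i * (w * star w) * star (n i) = ∑ i, r * (m i * (w * star w) * star (m i)) * r := by
        refine Finset.sum_congr rfl fun i _ => ?_
        rw [h1, ← hne, ← h1, star_mul, c.hrp.1.star_eq]
        simp only [mul_assoc]
    _ = r := by rw [← Finset.sum_mul, ← Finset.mul_sum, hs, mul_one, c.hrp.2.eq]

theorem Wt.basic (c : Wt M N τ p r w ψ) : {x ∈ Set.centralizer (Set.centralizer
            (corner r (N : Set (Op H)) ∪ {w * star w})) | r * x * r = x} =
          corner r (M : Set (Op H)) := by
  apply Set.Subset.antisymm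
  · rintro x ⟨hx, hxr⟩
    refine ⟨mem_cc.mpr ?_, hxr⟩
    refine fun y hy => hx y ?_
    rintro z (hz | rfl)
    · exact hy z (c.hNM hz.1)
    · exact hy _ c.eM
  · rintro x ⟨hx, hxr⟩
    refine ⟨?_, hxr⟩
    obtain ⟨ι, _, n, hn, hs⟩ := c.basis
    choose k hk hke using fun i => c.pull' (mul_mem hx (c.hNM (hn i).1))
      (by rw [← mul_assoc, corner_left c.hrp hxr])
    have hx2 : x = ∑ i, k i * (w * star w) * star (n i) := by
      have h0 := corner_right c.hrp hxr
      rw [← hs, Finset.mul_sum] at h0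
      refine h0.symm.trans ?_
      refine Finset.sum_congr rfl fun i _ => ?_
      rw [← hke]; simp only [mul_assoc]
    intro T hT
    rw [hx2, Finset.mul_sum, Finset.sum_mul]
    refine Finset.sum_congr rfl fun i _ => ?_
    have a1 := hT _ (Or.inl (hk i))
    have a2 := hT _ (Or.inr rfl)
    have a3 := hT _ (Or.inl (corner_star (M := N) c.hrp (hn i)))
    rw [mul_assoc _ (star (n i)), a3, ← mul_assoc _ T, mul_assoc (k i) _ T, a2, ← mul_assoc (k i) T, a1]
    simp only [mul_assoc]

theorem Wt.exp (c : Wt M N τ p r w ψ) {E : Op H → Op H}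
    (hE : IsCondExp τ (corner r (N : Set (Op H))) {y | ∃ x ∈ corner p (M : Set (Op H)), y = ψ x} E)
    {y : Op H} (hy : y ∈ corner r (N : Set (Op H))) : E y = ψ (star w * y * w) := by
  obtain ⟨x0, hx0, h0⟩ := hE.mem y hy
  rw [h0]
  refine c.uniqB hx0 (c.Cmem (c.hNM hy.1)) ?_
  intro z hz
  rw [c.trF hy.1 hz, corner_left c.hrp hy.2]
  have hpC : p ∈ corner p (M : Set (Op H)) := ⟨c.hp, by rw [c.hpp.2.eq, c.hpp.2.eq]⟩
  have h1 := hE.bimod r ⟨p, hpC, c.hψ1.symm⟩ y hy (ψ z) ⟨z, hz, rfl⟩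
  rw [corner_left c.hrp hy.2, h0, c.rψ hx0] at h1
  rw [← h1]
  apply hE.tr
  refine ⟨mul_mem hy.1 (c.ψN hz), ?_⟩
  rw [← mul_assoc, corner_left c.hrp hy.2, mul_assoc, c.ψr hz]

theorem Wt.zero (c : Wt M N τ p r w ψ) {a : Op H} (ha : a ∈ N) (har : a * r = a)
    (h : a * (w * star w) = 0) : a = 0 := by
  obtain ⟨l, hl, hh⟩ := c.tr_e
  have hl' : (l : ℂ) ≠ 0 := by exact_mod_cast hl.ne'
  have h1 := hh _ (mul_mem (star_mem ha) ha)
  have ha' : r * star a = star a := by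
    have := congrArg star har
    rwa [star_mul, c.hrp.1.star_eq] at this
  have haM := c.hNM ha
  rw [c.hM.trace.tracial _ c.eM _ (mul_mem (star_mem haM) haM), mul_assoc, h, mul_zero, map_zero, ← mul_assoc,
    ha'] at h1
  refine c.hM.trace.faithful a haM ?_
  rcases mul_eq_zero.mp h1.symm with h2 | h2
  · exact absurd h2 hl'
  · exact h2

end wt

end part10

section part11

section idx
variable {M N : VonNeumannAlgebra H} {τ : Op H →ₗ[ℂ] ℂ} {p r w : Op H} {ψ : Op H → Op H}

theorem sqrt_mem {x : Op H} (hx : x ∈ M) (h : 0 ≤ x) : ∃ s ∈ M, star s = s ∧ s * s = x := by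
  exact ⟨CFC.sqrt x, mem_cc.mpr (cent_sqrt (mem_cc.mp hx)),
    (IsSelfAdjoint.of_nonneg (CFC.sqrt_nonneg x)).star_eq, CFC.sqrt_mul_sqrt_self x h⟩

theorem sqrt_corner {e x : Op H} (he : IsProjection e) (hx : x ∈ corner e (M : Set (Op H))) (h : 0 ≤ x) :
    ∃ s ∈ corner e (M : Set (Op H)), star s = s ∧ s * s = x := by
  obtain ⟨s, hs, hss, hsx⟩ := sqrt_mem (M := M) hx.1 h
  have h1 : s * (1 - e) = 0 := by
    apply star_mul_self_zero
    rw [star_mul, hss, mul_assoc, ← mul_assoc s, hsx, mul_sub, mul_sub, corner_right he hx.2]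
    simp
  have h2 : s * e = s := by
    rw [mul_sub, mul_one, sub_eq_zero] at h1; exact h1.symm
  have h3 : e * s = s := by
    have := congrArg star h2
    rwa [star_mul, hss, he.1.star_eq] at this
  exact ⟨s, ⟨hs, by rw [h3, h2]⟩, hss, hsx⟩

theorem re_star_mul (b : Op H) (ξ : H) : (inner ℂ ((star b * b) ξ) ξ).re = ‖b ξ‖ ^ 2 := by
  rw [opmul, inner_star_left]
  exact inner_self_eq_norm_sq (𝕜 := ℂ) (b ξ)

theorem re_smul (c : ℝ) (X : Op H) (ξ : H) :
    (inner ℂ ((c • X) ξ) ξ).re = c * (inner ℂ (X ξ) ξ).re := by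
  have : (c • X) ξ = (c : ℂ) • X ξ := rfl
  rw [this, inner_smul_left]
  simp

theorem op_cs {ι : Type} [Fintype ι] (n b : ι → Op H) (X : Op H) (hX : 0 ≤ X)
    (hb : ∀ i, star (b i) * b i ≤ X) :
      star (∑ i, n i * b i) * (∑ i, n i * b i) ≤ ((∑ i, ‖n i‖ ^ 2) * Fintype.card ι + 1) • X := by
  set s := ∑ i, n i * b i with hs
  have hbn : ∀ i ξ, ‖b i ξ‖ ^ 2 ≤ (inner ℂ (X ξ) ξ).re := by
    intro i ξ
    rw [← re_star_mul]
    exact re_inner_le (hb i) ξ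
  refine le_of_re (IsSelfAdjoint.star_mul_self s) (by
    rw [isSelfAdjoint_iff, star_smul, (IsSelfAdjoint.of_nonneg hX).star_eq, star_trivial]) ?_
  intro ξ
  have hX0 : 0 ≤ (inner ℂ (X ξ) ξ).re := (Complex.le_def.mp ((nonneg_iff_inner X).mp hX ξ)).1
  have e1 : ‖s ξ‖ ≤ ∑ i, ‖n i‖ * ‖b i ξ‖ := by
    rw [hs, ContinuousLinearMap.sum_apply]
    refine (norm_sum_le _ _).trans (Finset.sum_le_sum fun i _ => ?_)
    rw [opmul]; exact (n i).le_opNorm _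
  have e2 : ‖s ξ‖ ^ 2 ≤ (∑ i, ‖n i‖ ^ 2) * ∑ i, ‖b i ξ‖ ^ 2 :=
    (pow_le_pow_left₀ (norm_nonneg _) e1 2).trans (Finset.sum_mul_sq_le_sq_mul_sq _ _ _)
  have e3 : ∑ i, ‖b i ξ‖ ^ 2 ≤ Fintype.card ι * (inner ℂ (X ξ) ξ).re := by
    refine (Finset.sum_le_sum fun i _ => hbn i ξ).trans ?_
    simp
  rw [re_star_mul, re_smul]
  have e6 := mul_le_mul_of_nonneg_left e3 (show 0 ≤ ∑ i, ‖n i‖ ^ 2 by positivity)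
  nlinarith

theorem Wt.ψpos (c : Wt M N τ p r w ψ) {x : Op H} (hx : x ∈ corner p (M : Set (Op H))) (h : 0 ≤ x) :
    0 ≤ ψ x := by
  obtain ⟨s, hs, hss, hsx⟩ := sqrt_corner (M := M) c.hpp hx h
  rw [← hsx, c.hψ.2.2.1 s hs s hs]
  nth_rw 1 [← hss]
  rw [c.hψ.2.2.2.2 s hs]
  exact star_mul_self_nonneg _

theorem Wt.ψmono (c : Wt M N τ p r w ψ) {x y : Op H} (hx : x ∈ corner p (M : Set (Op H)))
    (hy : y ∈ corner p (M : Set (Op H))) (h : x ≤ y) : ψ x ≤ ψ y := by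
  obtain ⟨h1, h2⟩ := c.ψsub hy hx
  have := c.ψpos h1 (sub_nonneg.mpr h)
  rw [h2] at this
  exact sub_nonneg.mp this

theorem Wt.index1 (c : Wt M N τ p r w ψ) {E : Op H → Op H}
    (hE : ∀ y ∈ corner r (N : Set (Op H)), E y = ψ (star w * y * w)) :
    HasFiniteIndex (corner r (N : Set (Op H))) E := by
  obtain ⟨ι, _, n, hn, hs⟩ := c.basis
  refine ⟨(∑ i, ‖n i‖ ^ 2) * Fintype.card ι + 1, by positivity, ?_⟩
  intro x hx hxpos
  rw [← ContinuousLinearMap.nonneg_iff_isPositive] at hxpos ⊢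
  rw [sub_nonneg, hE x hx]
  obtain ⟨s, hsC, hss, hsx⟩ := sqrt_corner (M := N) c.hrp hx hxpos
  have hsM := c.hNM hsC.1
  have hnM := fun i => c.hNM (hn i).1
  set b : ι → Op H := fun i => ψ (star w * (star (n i) * s) * w) with hb
  have hC : ∀ i, star w * (star (n i) * s) * w ∈ corner p (M : Set (Op H)) := fun i =>
    c.Cmem (mul_mem (star_mem (hnM i)) hsM)
  have hsum : ∑ i, n i * b i = s := by
    have hbN : ∑ i, n i * b i ∈ N := sum_mem fun i _ => mul_mem (hn i).1 (c.ψN (hC i))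
    refine sub_eq_zero.mp (c.zero (sub_mem hbN hsC.1) ?_ ?_)
    · rw [sub_mul, corner_right c.hrp hsC.2, Finset.sum_mul]
      congr 1
      refine Finset.sum_congr rfl fun i _ => ?_
      rw [mul_assoc, c.ψr (hC i)]
    · rw [sub_mul, sub_eq_zero, Finset.sum_mul]
      have h0 := corner_left c.hrp hsC.2
      rw [← hs, Finset.sum_mul] at h0
      refine Eq.trans ?_ (congrArg (fun t => t * (w * star w)) h0)
      rw [Finset.sum_mul]
      refine Finset.sum_congr rfl fun i _ => ?_
      rw [mul_assoc, ← c.eme (mul_mem (star_mem (hnM i)) hsM)]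
      simp only [mul_assoc]
  have hX : 0 ≤ ψ (star w * x * w) :=
    c.ψpos (c.Cmem (c.hNM hx.1)) (star_left_conjugate_nonneg hxpos w)
  have hbx : ∀ i, star (b i) * b i ≤ ψ (star w * x * w) := by
    intro i
    have hC' := corner_star c.hpp (hC i)
    rw [hb]
    dsimp only
    rw [← c.hψ.2.2.2.2 _ (hC i), ← c.hψ.2.2.1 _ hC' _ (hC i)]
    have hle : n i * (w * star w) * star (n i) ≤ 1 := by
      refine le_trans ?_ (hs.trans_le (proj_le_one c.hrp))
      exact Finset.single_le_sum (f := fun i => n i * (w * star w) * star (n i))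
        (fun i _ => star_right_conjugate_nonneg (proj_nonneg c.ep) (n i)) (Finset.mem_univ i)
    have hle2 := star_left_conjugate_le_conjugate hle (s * w)
    have eq1 : star (s * w) * (n i * (w * star w) * star (n i)) * (s * w) =
        star (star w * (star (n i) * s) * w) * (star w * (star (n i) * s) * w) := by
      simp only [star_mul, star_star, hss, mul_assoc]
    have eq2 : star (s * w) * 1 * (s * w) = star w * x * w := by
      rw [← hsx]; simp only [star_mul, hss, mul_assoc, one_mul]
    rw [eq1, eq2] at hle2
    refine c.ψmono ?_ (c.Cmem (c.hNM hx.1)) hle2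
    refine ⟨mul_mem hC'.1 (hC i).1, ?_⟩
    rw [← mul_assoc, corner_left c.hpp hC'.2, mul_assoc, corner_right c.hpp (hC i).2]
  have := op_cs n b _ hX hbx
  rwa [hsum, hss, hsx] at this

theorem Wt.index2 (c : Wt M N τ p r w ψ) {E : Op H → Op H}
    (hE : IsCondExp τ (M : Set (Op H)) (N : Set (Op H)) E) :
    HasFiniteIndex (M : Set (Op H)) E := by
  obtain ⟨l, hl, hle⟩ := c.tr_e
  obtain ⟨ι, _, m, hm, hs⟩ := simple c.hM c.eM (proj_nonneg c.ep) c.ene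
  have hEe : E (w * star w) = l • r := by
    have h1 := hE.mem _ c.eM
    have h2 : l • r ∈ N := rsmul_memM _ c.hr
    refine tr_uniq (M := M) c.hM.trace (S := N) (c.hNM h1) (c.hNM h2)
      (star_mem (S := VonNeumannAlgebra H) (sub_mem h1 h2)) ?_
    intro y hy
    have h3 := hE.bimod 1 (one_mem N) _ c.eM y hy
    rw [one_mul, one_mul] at h3
    rw [← h3, hE.tr _ (mul_mem c.eM (c.hNM hy)), hle y hy, smul_mul_assoc, tr_rsmul]
  refine ⟨l⁻¹, by positivity, ?_⟩
  intro x hx hxpos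
  rw [← ContinuousLinearMap.nonneg_iff_isPositive] at hxpos ⊢
  obtain ⟨s, hsM, hss, hsx⟩ := sqrt_mem (M := M) hx hxpos
  choose n hn hnr hne using fun i => c.pull (mul_mem hsM (hm i))
  have h1 : ∀ a : Op H, a * (w * star w) * star a = (a * (w * star w)) * star (a * (w * star w)) := by
    intro a
    rw [star_mul, c.ep.1.star_eq, ← mul_assoc (a * (w * star w)), mul_assoc a (w * star w) (w * star w),
      c.ep.2.eq]
  have hx2 : x = ∑ i, n i * (w * star w) * star (n i) := by
    calc x = s * 1 * s := by rw [mul_one, hsx]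
      _ = ∑ i, s * (m i * (w * star w) * star (m i)) * s := by
        rw [← hs, Finset.mul_sum, Finset.sum_mul]
      _ = _ := by
        refine Finset.sum_congr rfl fun i _ => ?_
        rw [h1 (n i), ← hne, ← h1, star_mul, hss]
        simp only [mul_assoc]
  have hEsum : ∀ (t : Finset ι), ∑ i ∈ t, n i * (w * star w) * star (n i) ∈ M ∧
      E (∑ i ∈ t, n i * (w * star w) * star (n i)) = ∑ i ∈ t, l • (n i * r * star (n i)) := by
    classical
    have hmem : ∀ i, n i * (w * star w) * star (n i) ∈ M := fun i =>
      mul_mem (mul_mem (c.hNM (hn i)) c.eM) (star_mem (c.hNM (hn i)))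
    intro t
    refine ⟨sum_mem fun i _ => hmem i, ?_⟩
    induction t using Finset.induction_on with
    | empty =>
      have := hE.map_smul 0 1 (one_mem M)
      simpa using this
    | insert i t hi ih =>
      rw [Finset.sum_insert hi, Finset.sum_insert hi, hE.map_add _ (hmem i) _ (sum_mem fun i _ => hmem i), ih,
        hE.bimod _ (hn i) _ c.eM _ (star_mem (S := VonNeumannAlgebra H) (hn i)), hEe, mul_smul_comm,
        smul_mul_assoc]
  have h3 := (hEsum Finset.univ).2
  rw [← hx2] at h3
  rw [h3, ← Finset.smul_sum, smul_smul, inv_mul_cancel₀ hl.ne', one_smul, sub_nonneg, hx2]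
  refine Finset.sum_le_sum fun i _ => ?_
  have her : w * star w ≤ r := sub_nonneg.mp (proj_nonneg (proj_sub c.ep c.hrp c.er))
  exact star_right_conjugate_le_conjugate her (n i)

end idx

end part11

/-- the forward direction of Proposition 2.3, detailed. Given an
irreducible inclusion `N ⊆ M` of II₁ factors and an intertwining witness
`(p, q, φ, v)` of `M ≺_M N` with `φ` unital, one can cut by a nonzero projection
`r ∈ φ(pMp)' ∩ qNq` so that the cut-down `B_r = rφ(pMp)r` has trivial relative
commutant in `rNr`; then `⟨rNr, ww*⟩ = rMr` is the basic construction of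
`B_r ⊆ rNr` (the Jones projection `ww*` implements the expectation onto `B_r`),
`B_r ⊆ rNr` has finite Jones index, and consequently `[M : N] < ∞`. -/
theorem basic_construction_from_intertwining
    {H : Type u} [NormedAddCommGroup H] [InnerProductSpace ℂ H] [CompleteSpace H]
    (M N : VonNeumannAlgebra H) (τ : Op H →ₗ[ℂ] ℂ)
    (hM : IsII1Factor M τ) (hN : IsII1Factor N τ)
    (hNM : (N : Set (Op H)) ⊆ (M : Set (Op H)))
    (hirr : relComm (N : Set (Op H)) (M : Set (Op H)) = scalars H)
    (p q v : Op H) (φ : Op H → Op H)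
    (hp : p ∈ M) (hpproj : IsProjection p) (hpne : p ≠ 0)
    (hq : q ∈ N) (hqproj : IsProjection q) (hqne : q ≠ 0)
    (hφ : IsStarHomOn φ (corner p (M : Set (Op H))) (corner q (N : Set (Op H))))
    (hφunital : φ p = q)
    (hv : v ∈ M) (hvne : v ≠ 0) (hvpi : IsProjection (star v * v)) (hvqp : q * v * p = v)
    (hint : ∀ x ∈ corner p (M : Set (Op H)), φ x * v = v * x) :
    ∃ r : Op H,
      IsProjection r ∧ r ≠ 0 ∧ r ∈ corner q (N : Set (Op H)) ∧
      (∀ x ∈ corner p (M : Set (Op H)), φ x * r = r * φ x) ∧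
      relComm {y | ∃ x ∈ corner p (M : Set (Op H)), y = r * φ x * r}
          (corner r (N : Set (Op H))) = {y | ∃ c : ℂ, y = c • r} ∧
      ∃ w : Op H,
        w ∈ (M : Set (Op H)) ∧ w ≠ 0 ∧ IsProjection (star w * w) ∧ r * w * p = w ∧
        (∀ x ∈ corner p (M : Set (Op H)), (r * φ x * r) * w = w * x) ∧
        {x ∈ Set.centralizer (Set.centralizer
            (corner r (N : Set (Op H)) ∪ {w * star w})) | r * x * r = x} =
          corner r (M : Set (Op H)) ∧
        (∀ E' : Op H → Op H,
          IsCondExp τ (corner r (N : Set (Op H)))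
            {y | ∃ x ∈ corner p (M : Set (Op H)), y = r * φ x * r} E' →
          (∀ y ∈ corner r (N : Set (Op H)),
            (w * star w) * y * (w * star w) = E' y * (w * star w)) ∧
          HasFiniteIndex (corner r (N : Set (Op H))) E') ∧
        (∀ EN : Op H → Op H, IsCondExp τ (M : Set (Op H)) (N : Set (Op H)) EN →
          HasFiniteIndex (M : Set (Op H)) EN) := by
  have c : Ctx M N τ p q v φ :=
    ⟨hM, hN, hNM, hirr, hp, hpproj, hpne, hq, hqproj, hφ, hφunital, hv, hvne, hvqp, hint⟩
  obtain ⟨r, hr, hrp, hrq, hrv, hcomm, hB⟩ := c.choose_r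
  obtain ⟨s, hs0, hsw⟩ := c.cut hr hrp hcomm hrv
  set w := s • (r * v) with hwd
  have hqr : q * r = r := by
    have := congrArg star hrq
    rwa [star_mul, hrp.1.star_eq, hqproj.1.star_eq] at this
  have hrφ : ∀ x ∈ corner p (M : Set (Op H)), r * φ x * r = φ x * r := by
    intro x hx; rw [← hcomm x hx, mul_assoc, hrp.2.eq]
  have hrφ2 : ∀ x ∈ corner p (M : Set (Op H)), r * φ x * r = r * φ x := by
    intro x hx; rw [hrφ x hx, hcomm x hx]
  have hrw : r * w = w := by rw [hwd, mul_smul_comm, ← mul_assoc, hrp.2.eq]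
  have hwp : w * p = w := by rw [hwd, smul_mul_assoc, mul_assoc, c.vp]
  have hwint : ∀ x ∈ corner p (M : Set (Op H)), (r * φ x * r) * w = w * x := by
    intro x hx
    rw [mul_assoc, hrw, hwd, mul_smul_comm, smul_mul_assoc, mul_assoc r v, ← hint x hx, mul_assoc r,
      ← mul_assoc (φ x), hcomm x hx, ← mul_assoc r, ← mul_assoc r, hrp.2.eq, mul_assoc]
  have W : Wt M N τ p r w (fun x => r * φ x * r) := by
    refine ⟨hM, hNM, hirr, hp, hpproj, hpne, hr, hrp, ?_, ?_, rsmul_memM _ (mul_mem (hNM hr) hv), hsw, hwp,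
      hrw, hwint, ?_⟩
    · refine ⟨?_, ?_, ?_, ?_, ?_⟩
      · intro x hx
        refine ⟨mul_mem (mul_mem hr (hφ.1 x hx).1) hr, ?_⟩
        simp only [mul_assoc, hrp.2.eq]
        rw [← mul_assoc r r, hrp.2.eq]
      · intro x hx y hy
        dsimp only
        rw [hφ.2.1 x hx y hy, mul_add, add_mul]
      · intro x hx y hy
        dsimp only
        rw [hrφ2 x hx, hrφ y hy, hφ.2.2.1 x hx y hy]
        simp only [mul_assoc]
      · intro k x hx
        dsimp only
        rw [hφ.2.2.2.1 k x hx, mul_smul_comm, smul_mul_assoc]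
      · intro x hx
        dsimp only
        rw [hφ.2.2.2.2 x hx, star_mul, star_mul, hrp.1.star_eq, mul_assoc]
    · rw [hφunital, hrq, hrp.2.eq]
    · intro y hy hyr hyc
      refine hB y hy hyr fun x hx => ?_
      have h := hyc x hx
      rw [hrφ x hx, mul_assoc, corner_left hrp hyr] at h
      rw [h, hcomm x hx, ← mul_assoc, corner_right hrp hyr]
  refine ⟨r, hrp, W.rne, ⟨hr, by rw [hqr, hrq]⟩, hcomm, ?_, w, W.hw, W.wne, ?_, ?_, hwint, W.basic, ?_, ?_⟩
  · ext y
    constructor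
    · rintro ⟨⟨hy, hyr⟩, h⟩
      exact W.hB y hy hyr fun x hx => h _ ⟨x, hx, rfl⟩
    · rintro ⟨k, rfl⟩
      refine ⟨⟨smul_memM k hr, ?_⟩, ?_⟩
      · rw [mul_smul_comm, smul_mul_assoc, hrp.2.eq, hrp.2.eq]
      · rintro _ ⟨x, hx, rfl⟩
        rw [mul_smul_comm, smul_mul_assoc, mul_assoc, hrp.2.eq, ← mul_assoc r, ← mul_assoc r, hrp.2.eq]
  · rw [hsw]; exact hpproj
  · rw [hrw, hwp]
  · intro E' hE'
    have hx := fun y hy => W.exp hE' (y := y) hy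
    refine ⟨?_, W.index1 hx⟩
    intro y hy
    rw [hx y hy]
    exact W.eme (hNM hy.1)
  · intro EN hEN
    exact W.index2 hEN

end PopaQ
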